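/- arXiv:1809.00114 — 2 statements merged into one kernel-verified Lean document; each statement's English description precedes it below -/
import Mathlib

section
/- (Laurent phenomenon of Fomin–Zelevinsky) Every cluster variable obtained from the initial seed ((X_1,…,X_r), B) by a finite sequence of mutations is, as an element of F = ℚ(X_1,…,X_r), a Laurent polynomial with integer coefficients in the initial cluster variables, i.e. it lies in ℤ[X_1^{±1},…,X_r^{±1}]. -/
namespace Cluster

/-- The ambient field `F = ℚ(X_1, …, X_r)` of rational functions. -/
abbrev F (r : ℕ) : Type := FractionRing (MvPolynomial (Fin r) ℚ)

/-- The initial cluster variables `X_i ∈ F`. -/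
noncomputable def Xvar (r : ℕ) (i : Fin r) : F r :=
  algebraMap (MvPolynomial (Fin r) ℚ) (F r) (MvPolynomial.X i)

/-- Matrix mutation `μ_k(B)`. -/
def mutateB (r : ℕ) (B : Matrix (Fin r) (Fin r) ℤ) (kk : Fin r) :
    Matrix (Fin r) (Fin r) ℤ :=
  fun i j =>
    if i = kk ∨ j = kk then -B i j
    else B i j + (if B i kk < 0 then -1 else 1) * max (B i kk * B kk j) 0

/-- The exchange relation: the new cluster variable produced by mutation
in direction `kk`. -/
noncomputable def mutateVar (r : ℕ) (u : Fin r → F r)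
    (B : Matrix (Fin r) (Fin r) ℤ) (kk : Fin r) : F r :=
  ((∏ i ∈ Finset.univ.filter fun i => 0 < B i kk, u i ^ (B i kk).toNat) +
      ∏ i ∈ Finset.univ.filter fun i => B i kk < 0, u i ^ (-B i kk).toNat) /
    u kk

/-- Cluster mutation `μ_kk` on the tuple of cluster variables. -/
noncomputable def mutateU (r : ℕ) (u : Fin r → F r)
    (B : Matrix (Fin r) (Fin r) ℤ) (kk : Fin r) : Fin r → F r :=
  Function.update u kk (mutateVar r u B kk)

/-- `B` is skew-symmetrizable: `D B` is skew-symmetric for some diagonal `D`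
with positive integer entries. -/
def IsSkewSymmetrizable (r : ℕ) (B : Matrix (Fin r) (Fin r) ℤ) : Prop :=
  ∃ d : Fin r → ℤ, (∀ i, 0 < d i) ∧ ∀ i j, d i * B i j = -(d j * B j i)

/-- The seeds obtained from the initial seed `((X_1, …, X_r), B0)` by finite
sequences of mutations. -/
inductive IsSeed (r : ℕ) (B0 : Matrix (Fin r) (Fin r) ℤ) :
    (Fin r → F r) → Matrix (Fin r) (Fin r) ℤ → Prop where
  | init : IsSeed r B0 (Xvar r) B0
  | mutate {u : Fin r → F r} {B : Matrix (Fin r) (Fin r) ℤ} (kk : Fin r) :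
      IsSeed r B0 u B → IsSeed r B0 (mutateU r u B kk) (mutateB r B kk)

/-- `v ∈ F` is a cluster variable of the cluster algebra with initial seed
`((X_1, …, X_r), B0)`. -/
def IsClusterVariable (r : ℕ) (B0 : Matrix (Fin r) (Fin r) ℤ) (v : F r) : Prop :=
  ∃ u B, IsSeed r B0 u B ∧ ∃ i, v = u i

/-- `v ∈ F` is a cluster monomial: a monomial in the cluster variables of a
single cluster. -/
def IsClusterMonomial (r : ℕ) (B0 : Matrix (Fin r) (Fin r) ℤ) (v : F r) : Prop :=
  ∃ u B, IsSeed r B0 u B ∧ ∃ e : Fin r → ℕ, v = ∏ i, u i ^ e i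

end Cluster

namespace LP

open LaurentPolynomial in
/-- `α + β T` with `β` a unit is a non-zero-divisor in the Laurent polynomial ring. -/
lemma linear_nzd {R : Type*} [CommRing R] (α β : R) (hβ : IsUnit β)
    (f : LaurentPolynomial R) (h : (C α + C β * T 1) * f = 0) : f = 0 := by
  obtain ⟨n, f', hf'⟩ := LaurentPolynomial.exists_T_pow f
  have h1 : Polynomial.toLaurent ((Polynomial.C β * Polynomial.X + Polynomial.C α) * f') = 0 := by
    rw [map_mul, hf']
    simp only [map_add, map_mul, Polynomial.toLaurent_C, Polynomial.toLaurent_X]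
    calc _ = (C α + C β * T 1) * f * T n := by ring
      _ = 0 := by rw [h, zero_mul]
  have h2 : (Polynomial.C β * Polynomial.X + Polynomial.C α) * f' = 0 :=
    Polynomial.toLaurent_injective (by rw [h1, map_zero])
  have h3 : f' = 0 := by
    rcases subsingleton_or_nontrivial R with hs | hs
    · exact Subsingleton.elim _ _
    have hl : (Polynomial.C β * Polynomial.X + Polynomial.C α).leadingCoeff = β :=
      Polynomial.leadingCoeff_linear hβ.ne_zero
    have := Polynomial.mem_nonZeroDivisors_of_leadingCoeff
      (p := Polynomial.C β * Polynomial.X + Polynomial.C α)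
      (by rw [hl]; exact hβ.mem_nonZeroDivisors)
    exact (mul_left_mem_nonZeroDivisors_eq_zero_iff this).1 h2
  rw [h3, map_zero] at hf'
  have : f * T n * T (-n) = 0 := by rw [← hf', zero_mul]
  rwa [mul_assoc, ← T_add, add_neg_cancel, T_zero, mul_one] at this

/-- `q` is a non-zero-divisor modulo `z`. -/
def Nzd {R : Type*} [CommRing R] (z q : R) : Prop := ∀ g, z ∣ q * g → z ∣ g

lemma Nzd.mul {R : Type*} [CommRing R] {z q q' : R} (h : Nzd z q) (h' : Nzd z q') :
    Nzd z (q * q') := fun g hg => h' g (h _ (by rwa [← mul_assoc]))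

lemma Nzd.one {R : Type*} [CommRing R] (z : R) : Nzd z 1 := fun g hg => by simpa using hg

lemma Nzd.pow {R : Type*} [CommRing R] {z q : R} (h : Nzd z q) (n : ℕ) : Nzd z (q ^ n) := by
  induction n with
  | zero => simpa using Nzd.one z
  | succ n ih => rw [pow_succ]; exact ih.mul h

lemma Nzd.of_isUnit {R : Type*} [CommRing R] (z : R) {q : R} (h : IsUnit q) : Nzd z q :=
  fun g hg => by simpa using (h.dvd_mul_left).1 hg

lemma Nzd.add {R : Type*} [CommRing R] {z q : R} (h : Nzd z q) (s : R) :
    Nzd z (q + z * s) := fun g hg => h g <| by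
  have : q * g = (q + z * s) * g - z * (s * g) := by ring
  rw [this]
  exact dvd_sub hg (dvd_mul_right _ _)

/-- The ring of integer Laurent polynomials. -/
abbrev A (ι : Type) := AddMonoidAlgebra ℤ (ι → ℤ)

variable {ι : Type}

/-- Laurent monomials. -/
noncomputable def mon (v : ι → ℤ) : A ι := AddMonoidAlgebra.single v 1

lemma mon_add (v w : ι → ℤ) : mon (v + w) = mon v * mon w := by
  simp [mon, AddMonoidAlgebra.single_mul_single]

lemma mon_zero : mon (0 : ι → ℤ) = 1 := rfl

lemma mon_mul_neg (v : ι → ℤ) : mon v * mon (-v) = 1 := by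
  rw [← mon_add, add_neg_cancel, mon_zero]

lemma mon_isUnit (v : ι → ℤ) : IsUnit (mon v) :=
  IsUnit.of_mul_eq_one _ (mon_mul_neg v)

lemma mon_nsmul (n : ℕ) (v : ι → ℤ) : mon (n • v) = mon v ^ n := by
  induction n with
  | zero => simp [mon_zero]
  | succ n ih => rw [succ_nsmul, mon_add, ih, pow_succ]

lemma mon_sum {κ : Type} (s : Finset κ) (f : κ → ι → ℤ) :
    mon (∑ i ∈ s, f i) = ∏ i ∈ s, mon (f i) := by
  classical
  induction s using Finset.induction_on with
  | empty => simp [mon_zero]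
  | insert a s ha ih => rw [Finset.sum_insert ha, Finset.prod_insert ha, mon_add, ih]

/-- The variables. -/
noncomputable def Xa [DecidableEq ι] (i : ι) : A ι := mon (Pi.single i 1)

lemma prod_Xa [Fintype ι] [DecidableEq ι] (n : ι → ℕ) : ∏ i, Xa i ^ n i = mon (fun i => (n i : ℤ)) := by
  simp only [Xa, ← mon_nsmul]
  rw [← mon_sum]
  congr 1
  ext j
  simp [Finset.sum_apply, Pi.single_apply]

lemma hom_ext {R : Type*} [Ring R] {f g : A ι →+* R} (h : ∀ v, f (mon v) = g (mon v)) :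
    f = g := by
  apply AddMonoidAlgebra.ringHom_ext
  · intro n
    have : (AddMonoidAlgebra.single (0 : ι → ℤ) n : A ι) = (n : A ι) := rfl
    rw [this, map_intCast, map_intCast]
  · exact h

/-- ring homs out of the Laurent ring. -/
noncomputable def liftHom {R : Type*} [Ring R] (f : Multiplicative (ι → ℤ) →* R) : A ι →+* R :=
  (AddMonoidAlgebra.lift ℤ R (ι → ℤ) f).toRingHom

lemma liftHom_mon {R : Type*} [Ring R] (f : Multiplicative (ι → ℤ) →* R) (v : ι → ℤ) :
    liftHom f (mon v) = f (Multiplicative.ofAdd v) := by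
  simp [liftHom, mon]

open LaurentPolynomial in
/-- The grading coaction modulo `z`. -/
noncomputable def sig (φ : (ι → ℤ) →+ ℤ) (z : A ι) :
    A ι →+* LaurentPolynomial (A ι ⧸ Ideal.span {z}) :=
  liftHom
    { toFun := fun v => C (Ideal.Quotient.mk (Ideal.span {z}) (mon v.toAdd)) * T (φ v.toAdd)
      map_one' := by simp [mon_zero]
      map_mul' := fun v w => by
        simp only [toAdd_mul, mon_add, map_mul, map_add, T_add]
        ring }

open LaurentPolynomial in
lemma sig_mon (φ : (ι → ℤ) →+ ℤ) (z : A ι) (v : ι → ℤ) :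
    sig φ z (mon v) = C (Ideal.Quotient.mk (Ideal.span {z}) (mon v)) * T (φ v) := by
  simp [sig, liftHom_mon]

open LaurentPolynomial in
lemma sig_eval (φ : (ι → ℤ) →+ ℤ) (z g : A ι) :
    eval₂ (RingHom.id _) 1 (sig φ z g) = Ideal.Quotient.mk (Ideal.span {z}) g := by
  have : (eval₂ (RingHom.id (A ι ⧸ Ideal.span {z})) 1).comp (sig φ z) =
      Ideal.Quotient.mk (Ideal.span {z}) := by
    apply hom_ext
    intro v
    simp [sig_mon]
  exact congrArg (fun f => f g) this

open LaurentPolynomial in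
/-- Main non-zero-divisor criterion. `z = mon s * (mon v + mon v')` with `v,v'` of degree 0 -/
lemma nzd_of_grading (φ : (ι → ℤ) →+ ℤ) (z q : A ι) (hz : sig φ z z = 0)
    (α β : A ι ⧸ Ideal.span {z}) (hβ : IsUnit β) (hq : sig φ z q = C α + C β * T 1) :
    Nzd z q := by
  rintro g ⟨h, hh⟩
  have h1 : sig φ z (q * g) = 0 := by rw [hh, map_mul, hz, zero_mul]
  rw [map_mul, hq] at h1
  have h2 := linear_nzd α β hβ _ h1
  have h3 := sig_eval φ z g
  rw [h2, map_zero, eq_comm, Ideal.Quotient.eq_zero_iff_mem, Ideal.mem_span_singleton] at h3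
  exact h3

open LaurentPolynomial in
lemma sig_self_zero (φ : (ι → ℤ) →+ ℤ) (z : A ι) (s v w : ι → ℤ)
    (hz : z = mon s * (mon v + mon w)) (hvw : φ v = φ w) : sig φ z z = 0 := by
  have h0 : Ideal.Quotient.mk (Ideal.span {z}) (mon s * (mon v + mon w)) = 0 := by
    rw [← hz]; exact Ideal.Quotient.eq_zero_iff_mem.2 (Ideal.mem_span_singleton_self z)
  have h1 : sig φ z z = sig φ z (mon s * (mon v + mon w)) := congrArg _ hz
  rw [h1, map_mul, map_add, sig_mon, sig_mon, sig_mon, hvw]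
  calc _ = C (Ideal.Quotient.mk (Ideal.span {z}) (mon s * (mon v + mon w))) *
        (T (φ s) * T (φ w)) := by simp only [map_mul, map_add]; ring
    _ = 0 := by rw [h0, map_zero, zero_mul]

end LP

set_option linter.unusedSectionVars false

namespace LP

variable {ι : Type} [Fintype ι] [DecidableEq ι]

/-- Matrix mutation. -/
def mB (B : Matrix ι ι ℤ) (k : ι) : Matrix ι ι ℤ := fun i j =>
  if i = k ∨ j = k then -B i j
  else B i j + (if B i k < 0 then -1 else 1) * max (B i k * B k j) 0

/-- Skew-symmetrizable by `d`. -/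
def SS (d : ι → ℤ) (B : Matrix ι ι ℤ) : Prop :=
  (∀ i, 0 < d i) ∧ ∀ i j, d i * B i j = -(d j * B j i)

/-- Numerator of the exchange relation. -/
def num {R : Type*} [CommSemiring R] (u : ι → R) (B : Matrix ι ι ℤ) (k : ι) : R :=
  ∏ i, u i ^ (B i k).toNat + ∏ i, u i ^ (-B i k).toNat

lemma SS.diag {d : ι → ℤ} {B : Matrix ι ι ℤ} (h : SS d B) (k : ι) : B k k = 0 := by
  have h1 := h.2 k k
  have h2 := h.1 k
  have : d k * B k k = 0 := by linarith
  rcases mul_eq_zero.1 this with h | h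
  · omega
  · exact h

lemma SS.zero {d : ι → ℤ} {B : Matrix ι ι ℤ} (h : SS d B) {k j : ι} (h0 : B k j = 0) :
    B j k = 0 := by
  have h1 := h.2 j k
  have h2 := h.1 j
  rw [h0, mul_zero, neg_zero] at h1
  rcases mul_eq_zero.1 h1 with h | h
  · omega
  · exact h

lemma SS.neg_of_pos {d : ι → ℤ} {B : Matrix ι ι ℤ} (h : SS d B) {k j : ι} (h0 : 0 < B k j) :
    B j k < 0 := by
  have h1 := h.2 j k
  have h2 := h.1 j
  have h3 := h.1 k
  by_contra hc
  push Not at hc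
  have := mul_pos h3 h0
  have := mul_nonneg h2.le hc
  linarith

lemma SS.neg {d : ι → ℤ} {B : Matrix ι ι ℤ} (h : SS d B) : SS d (-B) :=
  ⟨h.1, fun i j => by have := h.2 i j; simp only [Matrix.neg_apply]; linarith⟩

lemma mB_formula (B : Matrix ι ι ℤ) (k i j : ι) (hi : i ≠ k) (hj : j ≠ k) :
    mB B k i j = B i j + max (B i k) 0 * B k j + B i k * max (-B k j) 0 := by
  simp only [mB, hi, hj, or_self, if_false]
  rcases lt_or_ge (B i k) 0 with h1 | h1 <;> rcases lt_or_ge (B k j) 0 with h2 | h2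
  · rw [if_pos h1, max_eq_left (mul_pos_of_neg_of_neg h1 h2).le, max_eq_right h1.le,
      max_eq_left (by omega)]
    ring
  · rw [if_pos h1, max_eq_right (mul_nonpos_of_nonpos_of_nonneg h1.le h2), max_eq_right h1.le,
      max_eq_right (by omega)]
    ring
  · rw [if_neg (by omega), max_eq_right (mul_nonpos_of_nonneg_of_nonpos h1 h2.le),
      max_eq_left h1, max_eq_left (by omega)]
    ring
  · rw [if_neg (by omega), max_eq_left (mul_nonneg h1 h2),
      max_eq_left h1, max_eq_right (by omega)]
    ring

lemma mB_left (B : Matrix ι ι ℤ) (k j : ι) : mB B k k j = -B k j := by simp [mB]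
lemma mB_right (B : Matrix ι ι ℤ) (k i : ι) : mB B k i k = -B i k := by simp [mB]

lemma mB_neg (B : Matrix ι ι ℤ) (k : ι) : mB (-B) k = -mB B k := by
  ext i j
  by_cases h : i = k ∨ j = k
  · simp [mB, h]
  · push Not at h
    rw [Matrix.neg_apply, mB_formula _ _ _ _ h.1 h.2, mB_formula _ _ _ _ h.1 h.2]
    simp only [Matrix.neg_apply, neg_neg]
    rcases le_total (B i k) 0 with h1 | h1 <;> rcases le_total (B k j) 0 with h2 | h2 <;>
      simp [h1, h2] <;> ring

lemma mB_mB (B : Matrix ι ι ℤ) (k : ι) : mB (mB B k) k = B := by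
  ext i j
  by_cases h : i = k ∨ j = k
  · simp [mB, h]
  · push Not at h
    rw [mB_formula _ _ _ _ h.1 h.2, mB_formula _ _ _ _ h.1 h.2, mB_left, mB_right]
    rcases le_total (B i k) 0 with h1 | h1 <;> rcases le_total (B k j) 0 with h2 | h2 <;>
      simp [h1, h2]

lemma SS.mB {d : ι → ℤ} {B : Matrix ι ι ℤ} (h : SS d B) (k : ι) : SS d (mB B k) := by
  refine ⟨h.1, fun i j => ?_⟩
  by_cases hh : i = k ∨ j = k
  · have h' : j = k ∨ i = k := hh.symm
    simp only [LP.mB, hh, h', if_true]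
    have := h.2 i j
    linarith
  · push Not at hh
    rw [mB_formula _ _ _ _ hh.1 hh.2, mB_formula _ _ _ _ hh.2 hh.1]
    have key : ∀ i, d i * max (B i k) 0 = d k * max (-B k i) 0 := by
      intro i
      have := h.2 i k
      rw [mul_max_of_nonneg _ _ (h.1 i).le, mul_max_of_nonneg _ _ (h.1 k).le, this]
      simp
    have e1 := key i
    have e2 := key j
    have e3 := h.2 i j
    have e4 := h.2 i k
    have e5 := h.2 j k
    linear_combination e3 + B k j * e1 + max (-B k j) 0 * e4 + B k i * e2 + max (-B k i) 0 * e5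

lemma mB_isUnit {B : Matrix ι ι ℤ} (h : IsUnit B) (k : ι) (hk : B k k = 0) :
    IsUnit (mB B k) := by
  let E : Matrix ι ι ℤ := 1 + Matrix.vecMulVec (fun i => if i = k then -2 else max (B i k) 0)
    (Pi.single k 1)
  let G : Matrix ι ι ℤ := 1 + Matrix.vecMulVec (Pi.single k 1)
    (fun j => if j = k then -2 else max (-B k j) 0)
  have hE : E * E = 1 := by
    simp only [E, mul_add, add_mul, one_mul, mul_one, Matrix.vecMulVec_mul_vecMulVec]
    simp only [single_dotProduct, one_mul, if_true]
    ext i j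
    simp [Matrix.vecMulVec_apply]
    split_ifs <;> ring
  have hG : G * G = 1 := by
    simp only [G, mul_add, add_mul, one_mul, mul_one, Matrix.vecMulVec_mul_vecMulVec]
    simp only [dotProduct_single, mul_one, if_true]
    ext i j
    simp [Matrix.vecMulVec_apply]
    split_ifs <;> ring
  have hEu : IsUnit E := IsUnit.of_mul_eq_one _ hE
  have hGu : IsUnit G := IsUnit.of_mul_eq_one _ hG
  have : mB B k = E * B * G := by
    have e1 : ∀ i q, (E * B) i q = B i q + (if i = k then -2 else max (B i k) 0) * B k q := by
      intro i q
      simp [E, add_mul, Matrix.vecMulVec_mul, Matrix.vecMulVec_apply]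
    ext i j
    have e2 : (E * B * G) i j = (E * B) i j + (E * B) i k *
        (if j = k then -2 else max (-B k j) 0) := by
      simp [G, mul_add, Matrix.mul_vecMulVec, Matrix.vecMulVec_apply]
    rw [e2, e1, e1]
    by_cases hi : i = k
    · subst hi
      rw [mB_left]; simp [hk]; ring
    · by_cases hj : j = k
      · subst hj
        rw [mB_right]; simp [hk]; ring
      · rw [mB_formula _ _ _ _ hi hj]; simp [hi, hj, hk]
  rw [this]
  exact (hEu.mul h).mul hGu

lemma num_neg {R : Type*} [CommSemiring R] (u : ι → R) (B : Matrix ι ι ℤ) (k : ι) :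
    num u (-B) k = num u B k := by
  simp [num, add_comm]

lemma map_num {R S : Type*} [CommSemiring R] [CommSemiring S] (f : R →+* S) (u : ι → R)
    (B : Matrix ι ι ℤ) (k : ι) : f (num u B k) = num (fun i => f (u i)) B k := by
  simp [num]

lemma prod_update {R : Type*} [CommSemiring R] (u : ι → R) (k : ι) (s : R) (n : ι → ℕ) :
    ∏ i, (Function.update u k s) i ^ n i = s ^ n k * ∏ i, u i ^ (Function.update n k 0 i) := by
  rw [← Finset.mul_prod_erase _ _ (Finset.mem_univ k),
    ← Finset.mul_prod_erase Finset.univ (fun i => u i ^ (Function.update n k 0 i))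
      (Finset.mem_univ k)]
  simp only [Function.update_self, pow_zero, one_mul]
  congr 1
  apply Finset.prod_congr rfl
  intro i hi
  have := (Finset.mem_erase.1 hi).1
  simp [this]

end LP

namespace LP

variable {ι : Type} [Fintype ι] [DecidableEq ι]

lemma num_update {R : Type*} [CommSemiring R] (u : ι → R) (k : ι) (s : R)
    (B : Matrix ι ι ℤ) (j : ι) :
    num (Function.update u k s) B j =
      s ^ (B k j).toNat * ∏ i, u i ^ (Function.update (fun i => (B i j).toNat) k 0 i) +
      s ^ (-B k j).toNat * ∏ i, u i ^ (Function.update (fun i => (-B i j).toNat) k 0 i) := by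
  rw [num, prod_update, prod_update]

/-- positive part of a column -/
def pos (B : Matrix ι ι ℤ) (k : ι) : ι → ℤ := fun i => ((B i k).toNat : ℤ)
/-- negative part of a column -/
def neg (B : Matrix ι ι ℤ) (k : ι) : ι → ℤ := fun i => ((-B i k).toNat : ℤ)

/-- The mutated variable as Laurent polynomial. -/
noncomputable def zA (B : Matrix ι ι ℤ) (k : ι) : A ι :=
  mon (-Pi.single k 1) * (mon (pos B k) + mon (neg B k))

lemma num_Xa (B : Matrix ι ι ℤ) (k : ι) : num Xa B k = mon (pos B k) + mon (neg B k) := by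
  rw [num, prod_Xa, prod_Xa]; rfl

lemma zA_mul (B : Matrix ι ι ℤ) (k : ι) : zA B k * Xa k = num Xa B k := by
  rw [num_Xa, zA, Xa]
  linear_combination (mon (pos B k) + mon (neg B k)) * mon_mul_neg (Pi.single k 1 : ι → ℤ)

lemma zA_neg (B : Matrix ι ι ℤ) (k : ι) : zA (-B) k = zA B k := by
  have h1 : pos (-B) k = neg B k := rfl
  have h2 : neg (-B) k = pos B k := by ext i; simp [neg, pos]
  rw [zA, zA, h1, h2, add_comm]

/-- coordinate grading -/
def coord (k : ι) : (ι → ℤ) →+ ℤ := Pi.evalAddMonoidHom (fun _ : ι => ℤ) k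

lemma coord_apply (k : ι) (v : ι → ℤ) : coord k v = v k := rfl

open LaurentPolynomial in
lemma key_pos {d : ι → ℤ} {B : Matrix ι ι ℤ} (hB : SS d B) (k j : ι) (hkj : k ≠ j)
    (hpos : 0 < B k j) :
    ∃ y w : A ι, y * Xa j = num (Function.update Xa k (zA B k)) (mB B k) j ∧
      w * zA B k = num (Function.update (Function.update Xa k (zA B k)) j y)
        (mB (mB B k) j) k ∧ Nzd (zA B k) y ∧ Nzd (zA B k) w := by
  set z := zA B k with hz
  set B1 := mB B k with hB1
  set B2 := mB B1 j with hB2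
  have hBkk := hB.diag k
  have hS1 : SS d B1 := hB.mB k
  have hS2 : SS d B2 := hS1.mB j
  have hB2kk := hS2.diag k
  have hB1jj := hS1.diag j
  have hjk : B j k < 0 := hB.neg_of_pos hpos
  have h1kj : B1 k j = -B k j := mB_left _ _ _
  have h1jk : B1 j k = -B j k := mB_right _ _ _
  have h2jk : B2 j k = B j k := by rw [hB2, mB_left, h1jk, neg_neg]
  obtain ⟨a, ha⟩ : ∃ a : ℕ, B k j = (a : ℤ) + 1 := ⟨(B k j - 1).toNat, by omega⟩
  obtain ⟨b, hb⟩ : ∃ b : ℕ, B j k = -((b : ℤ) + 1) := ⟨(-B j k - 1).toNat, by omega⟩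
  set c' : ι → ℤ := (fun i => ((Function.update (fun i => (B1 i j).toNat) k 0 i : ℕ) : ℤ)) +
    -Pi.single j 1 with hc'
  set d' : ι → ℤ := (fun i => ((Function.update (fun i => (-B1 i j).toNat) k 0 i : ℕ) : ℤ)) +
    -Pi.single j 1 with hd'
  set l1 : ι → ℤ := (fun i => ((Function.update (Function.update (fun i => (B2 i k).toNat) j 0)
    k 0 i : ℕ) : ℤ)) with hl1
  set l2 : ι → ℤ := (fun i => ((Function.update (Function.update (fun i => (-B2 i k).toNat) j 0)
    k 0 i : ℕ) : ℤ)) with hl2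
  have hXj := mon_mul_neg (Pi.single j 1 : ι → ℤ)
  have hXk := mon_mul_neg (Pi.single k 1 : ι → ℤ)
  set y : A ι := mon c' + z ^ (a + 1) * mon d' with hy
  -- first exchange relation
  have E1 : y * Xa j = num (Function.update Xa k z) B1 j := by
    rw [num_update, prod_Xa, prod_Xa, h1kj, neg_neg, ha]
    have t1 : (-((a : ℤ) + 1)).toNat = 0 := by omega
    have t2 : ((a : ℤ) + 1).toNat = a + 1 := by omega
    rw [t1, t2, hy, hc', hd', mon_add, mon_add, Xa, pow_zero, one_mul]
    linear_combination (mon (fun i => ((Function.update (fun i => (B1 i j).toNat) k 0 i : ℕ) : ℤ))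
      + z ^ (a + 1) * mon (fun i => ((Function.update (fun i => (-B1 i j).toNat) k 0 i : ℕ) : ℤ)))
      * hXj
  -- exponent identity
  have hexp : l1 + pos B k = (b + 1) • c' + l2 + neg B k := by
    ext i
    simp only [hl1, hl2, hc', pos, neg, Pi.add_apply, Pi.smul_apply, Pi.neg_apply]
    by_cases hik : i = k
    · subst hik
      simp [hBkk, hkj]
    · by_cases hij : i = j
      · subst hij
        simp [hik, hB1jj, hb]
      · have h2 : B2 i k = -B i k + (b + 1) * max (B1 i j) 0 := by
          rw [hB2, mB_formula _ _ _ _ hij hkj, h1jk, hb, hB1, mB_right]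
          rw [max_eq_right (a := - - -((b : ℤ) + 1)) (by omega)]
          ring
        have h3 : ((B1 i j).toNat : ℤ) = max (B1 i j) 0 := by omega
        simp [hik, hij]
        have h4 : max (B i k) 0 - max (-B i k) 0 = B i k := by omega
        have h5 : max (B2 i k) 0 - max (-B2 i k) 0 = B2 i k := by omega
        linear_combination h5 + h2 + h4
  have hR : num (Function.update (Function.update Xa k z) j y) B2 k =
      mon l1 + y ^ (b + 1) * mon l2 := by
    rw [num_update, prod_update, prod_update, prod_Xa, prod_Xa, h2jk, hb, neg_neg]
    have t1 : (-((b : ℤ) + 1)).toNat = 0 := by omega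
    have t2 : ((b : ℤ) + 1).toNat = b + 1 := by omega
    rw [t1, t2]
    simp [hkj, hB2kk, hl1, hl2]
  have hzX : z * mon (Pi.single k 1) = mon (pos B k) + mon (neg B k) := by
    have := zA_mul B k
    rwa [num_Xa] at this
  obtain ⟨g, hg⟩ := Polynomial.powAddExpansion (mon c') (z ^ (a + 1) * mon d') (b + 1)
  have hg' : y ^ (b + 1) = mon c' ^ (b + 1) + ((b + 1 : ℕ) : A ι) * mon c' ^ b *
      (z ^ (a + 1) * mon d') + g * (z ^ (a + 1) * mon d') ^ 2 := by
    rw [hy, hg]; simp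
  have hL := congrArg mon hexp
  rw [mon_add, mon_add, mon_add, mon_nsmul] at hL
  have hP := mon_mul_neg (pos B k)
  set m : A ι := mon (l2 + (b + 1) • c' + -pos B k + Pi.single k 1) with hm
  have hm' : m = mon l2 * mon c' ^ (b + 1) * mon (-pos B k) * mon (Pi.single k 1) := by
    rw [hm, mon_add, mon_add, mon_add, mon_nsmul]
  refine ⟨y, m + mon l2 * ((b + 1 : ℕ) : A ι) * mon c' ^ b * mon d' * z ^ a +
    mon l2 * g * mon d' ^ 2 * z ^ (2 * a + 1), E1, ?_, ?_, ?_⟩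
  · rw [hR, hg', hm']
    have e1 : z ^ (2 * a + 1) * z = (z ^ (a + 1)) ^ 2 := by ring
    linear_combination (mon l2 * mon c' ^ (b + 1) * mon (-pos B k)) * hzX
      + (mon l2 * mon c' ^ (b + 1) + mon l1) * hP - mon (-pos B k) * hL
  · have := (Nzd.of_isUnit z (mon_isUnit c')).add (z ^ a * mon d')
    have e : y = mon c' + z * (z ^ a * mon d') := by rw [hy]; ring
    rw [e]; exact this
  · have hc0 : coord k c' = 0 := by simp [coord_apply, hc', hkj]
    have hd0 : coord k d' = 0 := by simp [coord_apply, hd', hkj]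
    have hl0 : coord k l2 = 0 := by simp [coord_apply, hl2]
    have hp0 : coord k (pos B k) = 0 := by simp [coord_apply, pos, hBkk]
    have hn0 : coord k (neg B k) = 0 := by simp [coord_apply, neg, hBkk]
    have hm0 : coord k (l2 + (b + 1) • c' + -pos B k + Pi.single k 1) = 1 := by
      rw [map_add, map_add, map_add, map_nsmul, map_neg, hc0, hl0, hp0]
      simp [coord_apply]
    have hzz : sig (coord k) z z = 0 :=
      sig_self_zero (coord k) z _ _ _ hz (hp0.trans hn0.symm)
    have hsm : sig (coord k) z m = C (Ideal.Quotient.mk (Ideal.span {z}) m) * T 1 := by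
      conv_lhs => rw [hm, sig_mon, hm0]
    have hmu : IsUnit (Ideal.Quotient.mk (Ideal.span {z}) m) := (mon_isUnit _).map _
    rcases Nat.eq_zero_or_pos a with ha0 | ha0
    · have hh : mon l2 * ((b + 1 : ℕ) : A ι) * mon c' ^ b * mon d' =
          ((b + 1 : ℕ) : A ι) * mon (l2 + b • c' + d') := by
        rw [mon_add (l2 + b • c') d', mon_add l2, mon_nsmul]; ring
      have hx0 : coord k (l2 + b • c' + d') = 0 := by
        rw [map_add, map_add, map_nsmul, hc0, hl0, hd0]; simp
      have N : Nzd z (m + mon l2 * ((b + 1 : ℕ) : A ι) * mon c' ^ b * mon d') := by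
        refine nzd_of_grading (coord k) z _ hzz (((b + 1 : ℕ) : A ι ⧸ Ideal.span {z}) *
          Ideal.Quotient.mk (Ideal.span {z}) (mon (l2 + b • c' + d'))) _ hmu ?_
        rw [hh, map_add, hsm, map_mul, sig_mon, hx0, T_zero, mul_one, map_natCast, map_mul,
          map_natCast, add_comm]
      have := N.add (mon l2 * g * mon d' ^ 2)
      convert this using 1
      rw [ha0]; ring
    · obtain ⟨a', rfl⟩ : ∃ a', a = a' + 1 := ⟨a - 1, by omega⟩
      have N : Nzd z m := by
        refine nzd_of_grading (coord k) z _ hzz 0 _ hmu ?_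
        rw [hsm, map_zero, zero_add]
      have := N.add (mon l2 * ((b + 1 : ℕ) : A ι) * mon c' ^ b * mon d' * z ^ a' +
        mon l2 * g * mon d' ^ 2 * z ^ (2 * (a' + 1)))
      convert this using 1
      ring

open LaurentPolynomial in
lemma key_zero {d : ι → ℤ} {B : Matrix ι ι ℤ} (hB : SS d B) (hU : IsUnit B) (k j : ι)
    (hkj : k ≠ j) (h0 : B k j = 0) :
    ∃ y w : A ι, y * Xa j = num (Function.update Xa k (zA B k)) (mB B k) j ∧
      w * zA B k = num (Function.update (Function.update Xa k (zA B k)) j y)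
        (mB (mB B k) j) k ∧ Nzd (zA B k) y ∧ Nzd (zA B k) w := by
  have h0' := hB.zero h0
  have hBkk := hB.diag k
  have hBjj := hB.diag j
  have e1 : ∀ i, mB B k i j = B i j := by
    intro i
    by_cases hi : i = k
    · subst hi; rw [mB_left, h0, neg_zero]
    · rw [mB_formula _ _ _ _ hi hkj.symm, h0]; simp
  have e2 : ∀ i, mB (mB B k) j i k = -B i k := by
    intro i
    by_cases hi : i = j
    · subst hi; rw [mB_left, mB_right, neg_neg, h0']; simp
    · rw [mB_formula _ _ _ _ hi hkj, mB_right, mB_right, h0']; simp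
  have f1 : ∀ n : ι → ℕ, n k = 0 → Function.update n k 0 = n := by
    intro n hn; rw [← hn, Function.update_eq_self]
  have f2 : ∀ n : ι → ℕ, n j = 0 → Function.update n j 0 = n := by
    intro n hn; rw [← hn, Function.update_eq_self]
  refine ⟨zA B j, Xa k, ?_, ?_, ?_, ?_⟩
  · rw [zA_mul, num_update, num]
    simp only [e1, h0]
    rw [f1 _ (by simp [h0]), f1 _ (by simp [h0])]
    simp
  · rw [mul_comm, zA_mul, num_update, prod_update, prod_update, num]
    simp only [e2, h0', neg_neg]
    rw [f2 _ (by simp [h0']), f2 _ (by simp [h0']), f1 _ (by simp [hBkk]), f1 _ (by simp [hBkk])]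
    simp [hBkk, add_comm]
  · obtain ⟨U, rfl⟩ := hU
    let φ : (ι → ℤ) →+ ℤ :=
      { toFun := fun v => ((U⁻¹).1.mulVec v) j
        map_zero' := by simp
        map_add' := fun v w => by rw [Matrix.mulVec_add]; rfl }
    have hcol : ∀ l, φ (fun i => U.1 i l) = (1 : Matrix ι ι ℤ) j l := by
      intro l
      rw [← U.inv_mul]
      rfl
    have hpn : ∀ l, pos U.1 l = (fun i => U.1 i l) + neg U.1 l := by
      intro l
      ext i
      have := Int.toNat_sub_toNat_neg (U.1 i l)
      simp only [pos, neg, Pi.add_apply]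
      linarith
    have hk : φ (pos U.1 k) = φ (neg U.1 k) := by
      rw [hpn, map_add, hcol, Matrix.one_apply_ne hkj.symm, zero_add]
    have hzz : sig φ (zA U.1 k) (zA U.1 k) = 0 := sig_self_zero φ _ _ _ _ rfl hk
    have N : Nzd (zA U.1 k) (mon (fun i => U.1 i j) + 1) := by
      refine nzd_of_grading φ _ _ hzz 1 (Ideal.Quotient.mk _ (mon (fun i => U.1 i j)))
        ((mon_isUnit _).map _) ?_
      rw [map_add, sig_mon, hcol, Matrix.one_apply_eq, map_one, map_one, add_comm]
    have e : zA U.1 j = mon (-Pi.single j 1 + neg U.1 j) * (mon (fun i => U.1 i j) + 1) := by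
      rw [zA, hpn, mon_add, mon_add]; ring
    rw [e]
    exact (Nzd.of_isUnit _ (mon_isUnit _)).mul N
  · exact Nzd.of_isUnit _ (mon_isUnit _)

lemma key {d : ι → ℤ} {B : Matrix ι ι ℤ} (hB : SS d B) (hU : IsUnit B) (k j : ι)
    (hkj : k ≠ j) :
    ∃ y w : A ι, y * Xa j = num (Function.update Xa k (zA B k)) (mB B k) j ∧
      w * zA B k = num (Function.update (Function.update Xa k (zA B k)) j y)
        (mB (mB B k) j) k ∧ Nzd (zA B k) y ∧ Nzd (zA B k) w := by
  rcases lt_trichotomy (B k j) 0 with h | h | h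
  · have := key_pos hB.neg k j hkj (by rw [Matrix.neg_apply]; omega)
    simpa only [zA_neg, mB_neg, num_neg] using this
  · exact key_zero hB hU k j hkj h
  · exact key_pos hB k j hkj h

end LP

namespace LP

variable {ι : Type} [Fintype ι] [DecidableEq ι]

/-- Mutation of the cluster. -/
noncomputable def mU {K : Type*} [Field K] (u : ι → K) (B : Matrix ι ι ℤ) (k : ι) : ι → K :=
  Function.update u k (num u B k / u k)

/-- Iterated mutation, cluster part. -/
noncomputable def run {K : Type*} [Field K] : List ι → (ι → K) → Matrix ι ι ℤ → ι → K
  | [], u, _ => u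
  | k :: l, u, B => run l (mU u B k) (mB B k)

/-- Iterated mutation, matrix part. -/
def runB : List ι → Matrix ι ι ℤ → Matrix ι ι ℤ
  | [], B => B
  | k :: l, B => runB l (mB B k)

lemma runB_append (l : List ι) (k : ι) (B : Matrix ι ι ℤ) :
    runB (l ++ [k]) B = mB (runB l B) k := by
  induction l generalizing B with
  | nil => rfl
  | cons a l ih => exact ih _

lemma run_append {K : Type*} [Field K] (l : List ι) (k : ι) (u : ι → K) (B : Matrix ι ι ℤ) :
    run (l ++ [k]) u B = mU (run l u B) (runB l B) k := by
  induction l generalizing B u with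
  | nil => rfl
  | cons a l ih => exact ih _ _

/-- A positive cone (sub-semifield without zero). -/
structure Cone {K : Type*} [Field K] (S : Set K) : Prop where
  one : (1 : K) ∈ S
  add : ∀ a ∈ S, ∀ b ∈ S, a + b ∈ S
  mul : ∀ a ∈ S, ∀ b ∈ S, a * b ∈ S
  inv : ∀ a ∈ S, a⁻¹ ∈ S
  ne : ∀ a ∈ S, a ≠ 0

section cone
variable {K : Type*} [Field K] {S : Set K}

lemma Cone.pow (h : Cone S) {a : K} (ha : a ∈ S) (n : ℕ) : a ^ n ∈ S := by
  induction n with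
  | zero => simpa using h.one
  | succ n ih => rw [pow_succ]; exact h.mul _ ih _ ha

lemma Cone.prod (h : Cone S) {κ : Type} (s : Finset κ) (f : κ → K) (hf : ∀ i, f i ∈ S) :
    ∏ i ∈ s, f i ∈ S := by
  classical
  induction s using Finset.induction_on with
  | empty => simpa using h.one
  | insert a s ha ih => rw [Finset.prod_insert ha]; exact h.mul _ (hf a) _ ih

lemma Cone.num (h : Cone S) {u : ι → K} (hu : ∀ i, u i ∈ S) (B : Matrix ι ι ℤ) (k : ι) :
    num u B k ∈ S :=
  h.add _ (h.prod _ _ fun i => h.pow (hu i) _) _ (h.prod _ _ fun i => h.pow (hu i) _)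

lemma Cone.mU (h : Cone S) {u : ι → K} (hu : ∀ i, u i ∈ S) (B : Matrix ι ι ℤ) (k : ι) (i : ι) :
    mU u B k i ∈ S := by
  by_cases hi : i = k
  · subst hi
    rw [LP.mU, Function.update_self, div_eq_mul_inv]
    exact h.mul _ (h.num hu _ _) _ (h.inv _ (hu _))
  · rw [LP.mU, Function.update_of_ne hi]; exact hu i

lemma Cone.run (h : Cone S) (l : List ι) {u : ι → K} (hu : ∀ i, u i ∈ S) (B : Matrix ι ι ℤ)
    (i : ι) : run l u B i ∈ S := by
  induction l generalizing u B with
  | nil => exact hu i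
  | cons k l ih => exact ih (h.mU hu B k) _

/-- cone in a fraction field -/
lemma exists_cone {R : Type*} [CommRing R] [IsDomain R] (ε : R →+* ℚ) [Algebra R K]
    [IsFractionRing R K] : ∃ S : Set K, Cone S ∧ ∀ p : R, 0 < ε p → algebraMap R K p ∈ S := by
  have hne : ∀ q : R, 0 < ε q → algebraMap R K q ≠ 0 := by
    intro q hq h
    have : q = 0 := IsFractionRing.injective R K (by rw [h, map_zero])
    rw [this, map_zero] at hq
    exact lt_irrefl _ hq
  refine ⟨{f | ∃ p q : R, 0 < ε p ∧ 0 < ε q ∧ f = algebraMap R K p / algebraMap R K q},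
    ⟨?_, ?_, ?_, ?_, ?_⟩, ?_⟩
  · exact ⟨1, 1, by simp, by simp, by simp⟩
  · rintro a ⟨p, q, hp, hq, rfl⟩ b ⟨p', q', hp', hq', rfl⟩
    refine ⟨p * q' + q * p', q * q', by simp only [map_add, map_mul]; positivity,
      by simp only [map_mul]; positivity, ?_⟩
    rw [div_add_div _ _ (hne _ hq) (hne _ hq')]
    simp
  · rintro a ⟨p, q, hp, hq, rfl⟩ b ⟨p', q', hp', hq', rfl⟩
    refine ⟨p * p', q * q', by simp only [map_mul]; positivity,
      by simp only [map_mul]; positivity, ?_⟩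
    rw [div_mul_div_comm]
    simp
  · rintro a ⟨p, q, hp, hq, rfl⟩
    exact ⟨q, p, hq, hp, by rw [inv_div]⟩
  · rintro a ⟨p, q, hp, hq, rfl⟩
    exact div_ne_zero (hne _ hp) (hne _ hq)
  · intro p hp
    exact ⟨p, 1, hp, by simp, by simp⟩

end cone

lemma num_update_self {K : Type*} [Field K] (u : ι → K) (s : K) (B : Matrix ι ι ℤ) (k : ι)
    (hk : B k k = 0) : num (Function.update u k s) (mB B k) k = num u B k := by
  have f1 : ∀ n : ι → ℕ, n k = 0 → Function.update n k 0 = n := by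
    intro n hn; rw [← hn, Function.update_eq_self]
  rw [num_update, num]
  simp only [mB_right, neg_neg, hk]
  rw [f1 _ (by simp [hk]), f1 _ (by simp [hk])]
  simp [add_comm]

lemma mU_mU {K : Type*} [Field K] {S : Set K} (h : Cone S) {u : ι → K} (hu : ∀ i, u i ∈ S)
    (B : Matrix ι ι ℤ) (k : ι) (hk : B k k = 0) : mU (mU u B k) (mB B k) k = u := by
  have h1 := h.ne _ (h.num hu B k)
  have h2 := h.ne _ (hu k)
  rw [mU, mU, num_update_self _ _ _ _ hk]
  simp only [Function.update_self, Function.update_idem]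
  rw [div_div_cancel₀ h1, Function.update_eq_self]

/-- evaluation of Laurent polynomials -/
noncomputable def ev {K : Type*} [Field K] (x : ι → K) (hx : ∀ i, x i ≠ 0) : A ι →+* K :=
  liftHom
    { toFun := fun v => ∏ i, x i ^ (v.toAdd i)
      map_one' := by simp
      map_mul' := fun v w => by
        rw [← Finset.prod_mul_distrib]
        apply Finset.prod_congr rfl
        intro i _
        rw [toAdd_mul, Pi.add_apply, zpow_add₀ (hx i)] }

lemma ev_mon {K : Type*} [Field K] (x : ι → K) (hx : ∀ i, x i ≠ 0) (v : ι → ℤ) :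
    ev x hx (mon v) = ∏ i, x i ^ v i := by
  simp [ev, liftHom_mon]

lemma ev_Xa {K : Type*} [Field K] (x : ι → K) (hx : ∀ i, x i ≠ 0) (j : ι) :
    ev x hx (Xa j) = x j := by
  rw [Xa, ev_mon, Finset.prod_eq_single j]
  · simp
  · intro i _ hi; simp [hi]
  · simp

/-- The Laurent subring. -/
def Lr {K : Type*} [Field K] (x : ι → K) : Subring K :=
  Subring.closure (Set.range x ∪ Set.range fun i => (x i)⁻¹)

lemma ev_mem {K : Type*} [Field K] (x : ι → K) (hx : ∀ i, x i ≠ 0) (a : A ι) :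
    ev x hx a ∈ Lr x := by
  induction a using AddMonoidAlgebra.induction_on with
  | of v =>
    have : ev x hx (mon v) ∈ Lr x := by
      rw [ev_mon]
      refine Subring.prod_mem _ fun i _ => ?_
      have h1 : x i ∈ Lr x := Subring.subset_closure (Or.inl ⟨i, rfl⟩)
      have h2 : (x i)⁻¹ ∈ Lr x := Subring.subset_closure (Or.inr ⟨i, rfl⟩)
      obtain ⟨n, hn | hn⟩ := Int.eq_nat_or_neg (v i)
      · rw [hn, zpow_natCast]; exact Subring.pow_mem _ h1 n
      · rw [hn, zpow_neg, zpow_natCast, ← inv_pow]; exact Subring.pow_mem _ h2 n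
    exact this
  | add a b ha hb => rw [map_add]; exact Subring.add_mem _ ha hb
  | smul r a ha => rw [map_zsmul]; exact Subring.zsmul_mem _ ha r

/-- generic field -/
abbrev K0 (ι : Type) [Fintype ι] [DecidableEq ι] := FractionRing (A ι)

/-- generic variables -/
noncomputable def XK (i : ι) : K0 ι := algebraMap (A ι) (K0 ι) (Xa i)

/-- generic Laurent phenomenon for paths of length at most `n`. -/
def Good (d : ι → ℤ) (n : ℕ) : Prop :=
  ∀ B : Matrix ι ι ℤ, SS d B → IsUnit B → ∀ l : List ι, l.length ≤ n → ∀ i,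
    ∃ a : A ι, run l XK B i = algebraMap (A ι) (K0 ι) a

lemma generic_cone : ∃ S : Set (K0 ι), Cone S ∧ ∀ i, XK i ∈ S := by
  obtain ⟨S, hS, h⟩ := exists_cone (K := K0 ι) (liftHom (1 : Multiplicative (ι → ℤ) →* ℚ))
  exact ⟨S, hS, fun i => h _ (by rw [Xa, liftHom_mon]; simp)⟩

lemma alg_inj : Function.Injective (algebraMap (A ι) (K0 ι)) := IsFractionRing.injective _ _

lemma spec {d : ι → ℤ} {n : ℕ} (hG : Good d n) {K : Type*} [Field K] {S : Set K} (hS : Cone S)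
    {x : ι → K} (hx : ∀ i, x i ∈ S) {B : Matrix ι ι ℤ} (hB : SS d B) (hU : IsUnit B)
    (l : List ι) (hl : l.length ≤ n) :
    ∃ a : ι → A ι, (∀ i, run l XK B i = algebraMap (A ι) (K0 ι) (a i)) ∧
      ∀ i, run l x B i = ev x (fun i => hS.ne _ (hx i)) (a i) := by
  obtain ⟨S0, hS0, hX0⟩ := generic_cone (ι := ι)
  induction l using List.reverseRecOn with
  | nil => exact ⟨Xa, fun i => rfl, fun i => by rw [ev_Xa]; rfl⟩
  | append_singleton l k ih =>
    obtain ⟨a, ha, hax⟩ := ih (by simp at hl; omega)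
    choose a' ha' using hG B hB hU (l ++ [k]) hl
    refine ⟨a', ha', fun i => ?_⟩
    have e1 := ha' i
    rw [run_append] at e1 ⊢
    by_cases hi : i = k
    · subst hi
      rw [mU, Function.update_self] at e1 ⊢
      have n0 := hS0.ne _ (hS0.run l hX0 B i)
      have n1 := hS.ne _ (hS.run l hx B i)
      rw [div_eq_iff n0] at e1
      rw [div_eq_iff n1]
      have e2 : num a (runB l B) i = a' i * a i := by
        apply alg_inj
        rw [map_num, map_mul, ← ha i, ← e1]
        congr 1
        ext i; rw [ha]
      have e3 := congrArg (ev x (fun i => hS.ne _ (hx i))) e2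
      rw [map_num, map_mul, ← hax] at e3
      rw [← e3]
      congr 1
      ext i; rw [hax]
    · rw [mU, Function.update_of_ne hi] at e1 ⊢
      rw [ha] at e1
      rw [hax, alg_inj e1]

lemma spec_mem {d : ι → ℤ} {n : ℕ} (hG : Good d n) {K : Type*} [Field K] {S : Set K} (hS : Cone S)
    {x : ι → K} (hx : ∀ i, x i ∈ S) {B : Matrix ι ι ℤ} (hB : SS d B) (hU : IsUnit B)
    (l : List ι) (hl : l.length ≤ n) (i : ι) : run l x B i ∈ Lr x := by
  obtain ⟨a, -, h⟩ := spec hG hS hx hB hU l hl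
  rw [h]; exact ev_mem _ _ _

lemma denom {x : ι → K0 ι} (q : A ι) (h1 : ∀ i, ∃ a, x i = algebraMap (A ι) (K0 ι) a)
    (h2 : ∀ i, ∃ a, algebraMap (A ι) (K0 ι) q * (x i)⁻¹ = algebraMap (A ι) (K0 ι) a)
    {f : K0 ι} (hf : f ∈ Lr x) :
    ∃ (n : ℕ) (a : A ι), algebraMap (A ι) (K0 ι) (q ^ n) * f = algebraMap (A ι) (K0 ι) a := by
  induction hf using Subring.closure_induction with
  | mem f hf =>
    rcases hf with ⟨i, rfl⟩ | ⟨i, rfl⟩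
    · obtain ⟨a, ha⟩ := h1 i
      exact ⟨0, a, by simp [ha]⟩
    · obtain ⟨a, ha⟩ := h2 i
      exact ⟨1, a, by rw [pow_one]; exact ha⟩
  | zero => exact ⟨0, 0, by simp⟩
  | one => exact ⟨0, 1, by simp⟩
  | add f g _ _ hf hg =>
    obtain ⟨n, a, ha⟩ := hf
    obtain ⟨m, b, hb⟩ := hg
    refine ⟨n + m, q ^ m * a + q ^ n * b, ?_⟩
    rw [map_add, map_mul, map_mul, ← ha, ← hb]
    simp only [map_pow]; ring
  | neg f _ hf =>
    obtain ⟨n, a, ha⟩ := hf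
    exact ⟨n, -a, by rw [map_neg, ← ha]; ring⟩
  | mul f g _ _ hf hg =>
    obtain ⟨n, a, ha⟩ := hf
    obtain ⟨m, b, hb⟩ := hg
    refine ⟨n + m, a * b, ?_⟩
    rw [map_mul, ← ha, ← hb]
    simp only [map_pow]; ring

lemma descend {z q : A ι} (hz : z ≠ 0) (hN : Nzd z q) {f : K0 ι} (c : A ι)
    (hc : algebraMap (A ι) (K0 ι) q * f = algebraMap (A ι) (K0 ι) c) (n : ℕ) (a : A ι)
    (ha : algebraMap (A ι) (K0 ι) (z ^ n) * f = algebraMap (A ι) (K0 ι) a) :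
    ∃ a, f = algebraMap (A ι) (K0 ι) a := by
  induction n generalizing a with
  | zero => exact ⟨a, by simpa using ha⟩
  | succ n ih =>
    have h1 : q * a = z ^ (n + 1) * c := by
      apply alg_inj
      rw [map_mul, map_mul, ← ha, ← hc]; ring
    obtain ⟨a', rfl⟩ := hN a ⟨z ^ n * c, by rw [h1]; ring⟩
    have hz' : algebraMap (A ι) (K0 ι) z ≠ 0 := fun h => hz (alg_inj (by rw [h, map_zero]))
    apply ih a'
    apply mul_left_cancel₀ hz'
    rw [← map_mul, ← ha]
    simp only [map_pow]; ring

lemma good_step {d : ι → ℤ} {n : ℕ} (hG : Good d n) : Good d (n + 1) := by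
  intro B hB hU l hl i
  obtain ⟨S, hS, hX⟩ := generic_cone (ι := ι)
  have hUX : ∀ i, IsUnit (Xa i : A ι) := fun i => mon_isUnit _
  have hmU : ∀ k, mU XK B k = fun i => algebraMap (A ι) (K0 ι) (Function.update Xa k (zA B k) i) := by
    intro k
    ext i
    by_cases hi : i = k
    · subst hi
      rw [mU, Function.update_self, Function.update_self, div_eq_iff (hS.ne _ (hX i))]
      rw [XK, ← map_mul, zA_mul, map_num]; rfl
    · rw [mU, Function.update_of_ne hi, Function.update_of_ne hi]; rfl
  match l, hl with
  | [], _ => exact ⟨Xa i, rfl⟩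
  | [k], _ => exact ⟨_, congrFun (hmU k) i⟩
  | k :: j :: l, hl =>
    simp only [List.length_cons] at hl
    by_cases hkj : k = j
    · subst hkj
      obtain ⟨a, ha⟩ := hG B hB hU l (by omega) i
      refine ⟨a, ?_⟩
      rw [← ha, run, run, mU_mU hS hX _ _ (hB.diag k), mB_mB]
    obtain ⟨y, w, hy, hw, Ny, Nw⟩ := key hB hU k j hkj
    set x1 := mU XK B k with hx1
    set B1 := mB B k with hB1
    set x2 := mU x1 B1 j with hx2
    set B2 := mB B1 j with hB2
    set x3 := mU x2 B2 k with hx3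
    set B3 := mB B2 k with hB3
    have S1 : SS d B1 := hB.mB k
    have S2 : SS d B2 := S1.mB j
    have S3 : SS d B3 := S2.mB k
    have U1 : IsUnit B1 := mB_isUnit hU k (hB.diag k)
    have U2 : IsUnit B2 := mB_isUnit U1 j (S1.diag j)
    have U3 : IsUnit B3 := mB_isUnit U2 k (S2.diag k)
    have m1 : ∀ i, x1 i ∈ S := hS.mU hX B k
    have m2 : ∀ i, x2 i ∈ S := hS.mU m1 B1 j
    have m3 : ∀ i, x3 i ∈ S := hS.mU m2 B2 k
    have e1 : x1 = fun i => algebraMap (A ι) (K0 ι) (Function.update Xa k (zA B k) i) := hmU k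
    have e2 : x2 = fun i => algebraMap (A ι) (K0 ι)
        (Function.update (Function.update Xa k (zA B k)) j y i) := by
      ext i
      by_cases hi : i = j
      · subst hi
        rw [hx2, mU, Function.update_self, Function.update_self, div_eq_iff (hS.ne _ (m1 i)), e1]
        have : Function.update Xa k (zA B k) i = Xa i := Function.update_of_ne (Ne.symm hkj) _ _
        simp only [this]
        rw [← map_mul, hy, map_num]
      · rw [hx2, mU, Function.update_of_ne hi, Function.update_of_ne hi, e1]
    have x2k : x2 k = algebraMap (A ι) (K0 ι) (zA B k) := by
      rw [e2]; simp [hkj]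
    have x3k : x3 k = algebraMap (A ι) (K0 ι) w := by
      rw [hx3, mU, Function.update_self, div_eq_iff (hS.ne _ (m2 k)), x2k, ← map_mul, hw, map_num,
        e2]
    have x3j : x3 j = algebraMap (A ι) (K0 ι) y := by
      rw [hx3, mU, Function.update_of_ne (Ne.symm hkj), e2]; simp
    have x3i : ∀ i, i ≠ k → i ≠ j → x3 i = algebraMap (A ι) (K0 ι) (Xa i) := by
      intro i h1 h2
      rw [hx3, mU, Function.update_of_ne h1, e2]; simp [h1, h2]
    have x1k : x1 k = algebraMap (A ι) (K0 ι) (zA B k) := by rw [e1]; simp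
    have x1i : ∀ i, i ≠ k → x1 i = algebraMap (A ι) (K0 ι) (Xa i) := by
      intro i h1
      rw [e1]; simp [h1]
    have hXinv : ∀ i, ∃ a, (algebraMap (A ι) (K0 ι) (Xa i))⁻¹ = algebraMap (A ι) (K0 ι) a := by
      intro i
      refine ⟨mon (-Pi.single i 1), ?_⟩
      apply inv_eq_of_mul_eq_one_right
      rw [← map_mul, Xa, mon_mul_neg, map_one]
    -- the two memberships
    have F1 : run (k :: j :: l) XK B i ∈ Lr x1 :=
      spec_mem hG hS m1 S1 U1 (j :: l) (by simp; omega) i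
    have F3 : run (k :: j :: l) XK B i ∈ Lr x3 := by
      have h := spec_mem hG hS m3 S3 U3 (k :: l) (by simp; omega) i
      rw [run, hx3, hB3, mU_mU hS m2 _ _ (S2.diag k), mB_mB] at h
      exact h
    have hz0 : zA B k ≠ 0 := by
      intro h
      apply hS.ne _ (m1 k)
      rw [x1k, h, map_zero]
    have hy0 := hS.ne _ (m3 j)
    have hw0 := hS.ne _ (m3 k)
    have hzz := hS.ne _ (m1 k)
    obtain ⟨n1, a, ha⟩ := denom (zA B k) (x := x1)
      (fun i => ⟨_, congrFun e1 i⟩)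
      (fun i => by
        by_cases hi : i = k
        · subst hi
          exact ⟨1, by rw [← x1k, mul_inv_cancel₀ hzz, map_one]⟩
        · obtain ⟨b, hb⟩ := hXinv i
          exact ⟨zA B k * b, by rw [x1i i hi, hb, map_mul]⟩) F1
    obtain ⟨n3, c, hc⟩ := denom (y * w) (x := x3)
      (fun i => by
        by_cases hi : i = k
        · subst hi; exact ⟨_, x3k⟩
        · by_cases hj : i = j
          · subst hj; exact ⟨_, x3j⟩
          · exact ⟨_, x3i i hi hj⟩)
      (fun i => by
        by_cases hi : i = k
        · subst hi
          exact ⟨y, by rw [map_mul, ← x3k, mul_assoc, mul_inv_cancel₀ hw0, mul_one]⟩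
        · by_cases hj : i = j
          · subst hj
            exact ⟨w, by rw [map_mul, ← x3j, mul_comm, ← mul_assoc, inv_mul_cancel₀ hy0, one_mul]⟩
          · obtain ⟨b, hb⟩ := hXinv i
            exact ⟨y * w * b, by rw [x3i i hi hj, hb, ← map_mul]⟩) F3
    exact descend hz0 ((Ny.mul Nw).pow n3) c hc n1 a ha

lemma good_all (d : ι → ℤ) (n : ℕ) : Good d n := by
  induction n with
  | zero =>
    intro B _ _ l hl i
    have : l = [] := List.length_eq_zero_iff.1 (by omega)
    subst this
    exact ⟨Xa i, rfl⟩
  | succ n ih => exact good_step ih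

/-- Laurent phenomenon for unimodular exchange matrices. -/
theorem laurent_unimodular {d : ι → ℤ} {K : Type*} [Field K] {S : Set K} (hS : Cone S)
    {x : ι → K} (hx : ∀ i, x i ∈ S) {B : Matrix ι ι ℤ} (hB : SS d B) (hU : IsUnit B)
    (l : List ι) (i : ι) : run l x B i ∈ Lr x :=
  spec_mem (good_all d l.length) hS hx hB hU l le_rfl i

lemma run_restrict {K : Type*} [Field K] (l : List ι) (u : ι → K) (B : Matrix ι ι ℤ)
    (u' : ι ⊕ ι → K) (B' : Matrix (ι ⊕ ι) (ι ⊕ ι) ℤ) (h1 : ∀ i, u' (Sum.inl i) = u i)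
    (h2 : ∀ i, u' (Sum.inr i) = 1) (h3 : ∀ i j, B' (Sum.inl i) (Sum.inl j) = B i j) (i : ι) :
    run (l.map Sum.inl) u' B' (Sum.inl i) = run l u B i := by
  induction l generalizing u B u' B' with
  | nil => exact h1 i
  | cons k l ih =>
    refine ih _ _ _ _ ?_ ?_ ?_
    · intro i
      have hn : num u' B' (Sum.inl k) = num u B k := by
        simp only [num, Fintype.prod_sum_type, h1, h2, h3, one_pow, Finset.prod_const_one, mul_one]
      by_cases hi : i = k
      · subst hi
        rw [mU, mU, Function.update_self, Function.update_self, hn, h1]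
      · rw [mU, mU, Function.update_of_ne hi, Function.update_of_ne (by simpa using hi), h1]
    · intro i
      rw [mU, Function.update_of_ne (by simp), h2]
    · intro i j
      simp only [mB, h3, Sum.inl.injEq]

/-- General Laurent phenomenon. -/
theorem laurent_general {d : ι → ℤ} {K : Type*} [Field K] {S : Set K} (hS : Cone S)
    {x : ι → K} (hx : ∀ i, x i ∈ S) {B : Matrix ι ι ℤ} (hB : SS d B)
    (l : List ι) (i : ι) : run l x B i ∈ Lr x := by
  let B' : Matrix (ι ⊕ ι) (ι ⊕ ι) ℤ := Matrix.fromBlocks B (-1) 1 0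
  let x' : ι ⊕ ι → K := Sum.elim x 1
  have hB' : SS (Sum.elim d d) B' := by
    refine ⟨?_, ?_⟩
    · rintro (i | i) <;> exact hB.1 i
    · rintro (i | i) (j | j)
      · exact hB.2 i j
      · by_cases h : i = j
        · subst h; simp [B']
        · simp [B', h, Ne.symm h, Matrix.one_apply]
      · by_cases h : i = j
        · subst h; simp [B']
        · simp [B', h, Ne.symm h, Matrix.one_apply]
      · simp [B']
  have hU : IsUnit B' := by
    apply IsUnit.of_mul_eq_one (Matrix.fromBlocks 0 1 (-1) B)
    simp [B', Matrix.fromBlocks_multiply]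
  have hx' : ∀ i, x' i ∈ S := by
    rintro (i | i)
    · exact hx i
    · exact hS.one
  have := laurent_unimodular hS hx' hB' hU (l.map Sum.inl) (Sum.inl i)
  rw [run_restrict l x B x' B' (fun _ => rfl) (fun _ => rfl) (fun _ _ => rfl)] at this
  refine (Subring.closure_le.2 ?_) this
  rintro _ (⟨i | i, rfl⟩ | ⟨i | i, rfl⟩)
  · exact Subring.subset_closure (Or.inl ⟨i, rfl⟩)
  · exact Subring.one_mem _
  · exact Subring.subset_closure (Or.inr ⟨i, rfl⟩)
  · have : (x' (Sum.inr i))⁻¹ = 1 := by simp [x']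
    simp only [this]
    exact Subring.one_mem _

end LP

namespace Cluster

lemma mutateU_eq (r : ℕ) (u : Fin r → F r) (B : Matrix (Fin r) (Fin r) ℤ) (k : Fin r) :
    mutateU r u B k = LP.mU u B k := by
  rw [mutateU, LP.mU, mutateVar, LP.num, Finset.prod_filter, Finset.prod_filter]
  congr 3
  · apply Finset.prod_congr rfl
    intro i _
    split_ifs with h
    · rfl
    · rw [Int.toNat_of_nonpos (by omega), pow_zero]
  · apply Finset.prod_congr rfl
    intro i _
    split_ifs with h
    · rfl
    · rw [Int.toNat_of_nonpos (by omega), pow_zero]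

lemma isSeed_run (r : ℕ) (B0 : Matrix (Fin r) (Fin r) ℤ) (u : Fin r → F r)
    (B : Matrix (Fin r) (Fin r) ℤ) (h : IsSeed r B0 u B) :
    ∃ l : List (Fin r), u = LP.run l (Xvar r) B0 ∧ B = LP.runB l B0 := by
  induction h with
  | init => exact ⟨[], rfl, rfl⟩
  | mutate k _ ih =>
    obtain ⟨l, h1, h2⟩ := ih
    refine ⟨l ++ [k], ?_, ?_⟩
    · rw [LP.run_append, mutateU_eq, h1, h2]
    · rw [LP.runB_append, h2]; rfl

end Cluster

open Cluster

/-- **Laurent phenomenon, Fomin–Zelevinsky.** Every cluster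
variable obtained from the initial seed `((X_1, …, X_r), B0)` (with `B0`
skew-symmetrizable) by a finite sequence of mutations lies in
`ℤ[X_1^{±1}, …, X_r^{±1}]`, the subring of `F` generated by the `X_i` and
their inverses. -/
theorem laurent_phenomenon (r : ℕ) (hr : 1 ≤ r)
    (B0 : Matrix (Fin r) (Fin r) ℤ) (hB0 : IsSkewSymmetrizable r B0)
    (v : F r) (hv : IsClusterVariable r B0 v) :
    v ∈ Subring.closure
      (Set.range (Xvar r) ∪ Set.range fun i => (Xvar r i)⁻¹) := by
  obtain ⟨u, B, hs, i, rfl⟩ := hv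
  obtain ⟨l, rfl, -⟩ := isSeed_run r B0 u B hs
  obtain ⟨d, hd, hB⟩ := hB0
  obtain ⟨S, hS, hX⟩ := LP.exists_cone (K := F r)
    (MvPolynomial.eval (fun _ : Fin r => (1 : ℚ)))
  exact LP.laurent_general (d := d) hS (x := Xvar r) (fun i => hX _ (by simp)) ⟨hd, hB⟩ l i
end

section
/- (Linear independence of cluster monomials) Assume the initial exchange matrix B is skew-symmetric. Then the set of all cluster monomials, viewed as elements of F = ℚ(X_1,…,X_r), is linearly independent over ℚ: any finite collection of pairwise distinct cluster monomials is ℚ-linearly independent in F. -/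
open Cluster

namespace CLI
open AddMonoidAlgebra

/-- Laurent polynomials with integer coefficients. -/
abbrev Lau (I : Type) : Type := AddMonoidAlgebra ℤ (I → ℤ)

section alg
variable {I : Type}

/-- Laurent monomial. -/
noncomputable def mon (m : I → ℤ) : Lau I := single m 1

lemma mon_add (m n : I → ℤ) : (mon (m + n) : Lau I) = mon m * mon n := by
  simp [mon, single_mul_single]

lemma mon_zero : (mon (0 : I → ℤ) : Lau I) = 1 := rfl

lemma mon_neg_mul (m : I → ℤ) : (mon (-m) : Lau I) * mon m = 1 := by
  rw [← mon_add, neg_add_cancel, mon_zero]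

lemma mon_nsmul (n : ℕ) (m : I → ℤ) : (mon (n • m) : Lau I) = mon m ^ n := by
  simp [mon, single_pow]

lemma csa [DecidableEq (I → ℤ)] (m n : I → ℤ) (c : ℤ) :
    (single m c : Lau I).coeff n = if m = n then c else 0 := by
  rw [coeff_single, Finsupp.single_apply]

lemma coeff_mon_self (m : I → ℤ) : (mon m : Lau I).coeff m = 1 := by
  simp [mon]

lemma coeff_mon_of_ne {m n : I → ℤ} (h : m ≠ n) : (mon m : Lau I).coeff n = 0 := by
  classical
  rw [mon, csa, if_neg h]

/-- All exponents have weight at most `c`. -/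
def Bdd (l : (I → ℤ) →+ ℤ) (c : ℤ) (f : Lau I) : Prop := ∀ m, f.coeff m ≠ 0 → l m ≤ c

lemma Bdd.add {l : (I → ℤ) →+ ℤ} {c : ℤ} {f g : Lau I} (hf : Bdd l c f) (hg : Bdd l c g) :
    Bdd l c (f + g) := by
  intro m hm
  by_cases h : f.coeff m = 0
  · apply hg; intro h2; apply hm; simp [h, h2]
  · exact hf m h

lemma Bdd.mono {l : (I → ℤ) →+ ℤ} {c d : ℤ} {f : Lau I} (hf : Bdd l c f) (h : c ≤ d) :
    Bdd l d f := fun m hm => (hf m hm).trans h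

lemma Bdd.zero (l : (I → ℤ) →+ ℤ) (c : ℤ) : Bdd l c (0 : Lau I) := by
  intro m hm; simp at hm

lemma Bdd.sum {J : Type*} {l : (I → ℤ) →+ ℤ} {c : ℤ} (s : Finset J) {f : J → Lau I}
    (h : ∀ j ∈ s, Bdd l c (f j)) : Bdd l c (∑ j ∈ s, f j) := by
  classical
  induction s using Finset.induction_on with
  | empty => simpa using Bdd.zero l c
  | insert a s ha ih =>
    rw [Finset.sum_insert ha]
    exact (h a (by simp)).add (ih fun j hj => h j (by simp [hj]))

lemma Bdd.single (l : (I → ℤ) →+ ℤ) (m : I → ℤ) (c : ℤ) : Bdd l (l m) (single m c : Lau I) := by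
  classical
  intro n hn
  rw [csa] at hn
  split_ifs at hn with h
  · rw [h]
  · exact absurd rfl hn

lemma Bdd.mon (l : (I → ℤ) →+ ℤ) (m : I → ℤ) : Bdd l (l m) (mon m : Lau I) := Bdd.single l m 1

lemma Bdd.mul {l : (I → ℤ) →+ ℤ} {c d : ℤ} {f g : Lau I} (hf : Bdd l c f) (hg : Bdd l d g) :
    Bdd l (c + d) (f * g) := by
  classical
  intro m hm
  have := support_coeff_mul_subset f g (Finsupp.mem_support_iff.mpr hm)
  obtain ⟨a, ha, b, hb, rfl⟩ := Finset.mem_add.mp this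
  rw [map_add]
  exact add_le_add (hf a (Finsupp.mem_support_iff.mp ha)) (hg b (Finsupp.mem_support_iff.mp hb))

lemma Bdd.one (l : (I → ℤ) →+ ℤ) : Bdd l 0 (1 : Lau I) := by
  have := Bdd.mon l (0 : I → ℤ)
  rwa [map_zero, mon_zero] at this

lemma Bdd.pow {l : (I → ℤ) →+ ℤ} {c : ℤ} {f : Lau I} (hf : Bdd l c f) (n : ℕ) :
    Bdd l (n * c) (f ^ n) := by
  induction n with
  | zero => simpa using Bdd.one l
  | succ n ih => rw [pow_succ]; convert ih.mul hf using 1; push_cast; ring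

/-- Homogeneous component. -/
noncomputable def cpt (l : (I → ℤ) →+ ℤ) (d : ℤ) (f : Lau I) : Lau I :=
  ofCoeff (f.coeff.filter (fun m => l m = d))

lemma coeff_cpt (l : (I → ℤ) →+ ℤ) (d : ℤ) (f : Lau I) (m : I → ℤ) :
    (cpt l d f).coeff m = if l m = d then f.coeff m else 0 := by
  simp [cpt, Finsupp.filter_apply]

lemma cpt_add (l : (I → ℤ) →+ ℤ) (d : ℤ) (f g : Lau I) : cpt l d (f + g) = cpt l d f + cpt l d g := by
  ext m; simp [coeff_cpt]; split_ifs <;> simp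

lemma cpt_zero (l : (I → ℤ) →+ ℤ) (d : ℤ) : cpt l d (0 : Lau I) = 0 := by
  ext m; simp [coeff_cpt]

lemma cpt_sum {J : Type*} (l : (I → ℤ) →+ ℤ) (d : ℤ) (s : Finset J) (f : J → Lau I) :
    cpt l d (∑ j ∈ s, f j) = ∑ j ∈ s, cpt l d (f j) := by
  classical
  induction s using Finset.induction_on with
  | empty => ext; simp [coeff_cpt]
  | insert a s ha ih => rw [Finset.sum_insert ha, Finset.sum_insert ha, cpt_add, ih]

lemma cpt_single (l : (I → ℤ) →+ ℤ) (d : ℤ) (m : I → ℤ) (c : ℤ) :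
    cpt l d (single m c : Lau I) = if l m = d then single m c else 0 := by
  classical
  ext n
  rw [coeff_cpt, csa]
  by_cases h : m = n
  · subst h; by_cases h2 : l m = d <;> simp [h2]
  · by_cases h2 : l m = d <;> simp [h, h2]

lemma cpt_single_mul (l : (I → ℤ) →+ ℤ) (d : ℤ) (m : I → ℤ) (c : ℤ) (f : Lau I) :
    cpt l d (single m c * f) = single m c * cpt l (d - l m) f := by
  induction f using AddMonoidAlgebra.induction_linear with
  | zero => rw [mul_zero, cpt_zero, cpt_zero, mul_zero]
  | add f g hf hg => rw [mul_add, cpt_add, hf, hg, cpt_add, mul_add]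
  | single n b =>
    rw [single_mul_single, cpt_single, cpt_single, map_add]
    by_cases h : l n = d - l m
    · rw [if_pos h, if_pos (by omega), single_mul_single]
    · rw [if_neg h, if_neg (by omega), mul_zero]

lemma cpt_mul_homog (l : (I → ℤ) →+ ℤ) (d d0 : ℤ) (P h : Lau I)
    (hP : ∀ m, P.coeff m ≠ 0 → l m = d0) : cpt l d (P * h) = P * cpt l (d - d0) h := by
  have hs : P = ∑ m ∈ P.coeff.support, single m (P.coeff m) := by
    conv_lhs => rw [← sum_coeff_single P]
    rfl
  conv_lhs => rw [hs, Finset.sum_mul, cpt_sum]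
  conv_rhs => rw [hs, Finset.sum_mul]
  refine Finset.sum_congr rfl fun m hm => ?_
  rw [cpt_single_mul, hP m (Finsupp.mem_support_iff.mp hm)]

lemma cpt_eq_zero {l : (I → ℤ) →+ ℤ} {c d : ℤ} {f : Lau I} (hf : Bdd l c f) (h : c < d) :
    cpt l d f = 0 := by
  ext m
  rw [coeff_cpt]
  split_ifs with h1
  · by_contra h2
    have := hf m h2
    omega
  · rfl

lemma bdd_sub_cpt {l : (I → ℤ) →+ ℤ} {c : ℤ} {f : Lau I} (hf : Bdd l c f) :
    Bdd l (c - 1) (f - cpt l c f) := by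
  intro m hm
  rw [coeff_sub, Finsupp.sub_apply, coeff_cpt] at hm
  split_ifs at hm with h
  · simp at hm
  · have := hf m (by simpa using hm)
    omega

lemma cpt_homog (l : (I → ℤ) →+ ℤ) (d : ℤ) (f : Lau I) (m : I → ℤ) (h : (cpt l d f).coeff m ≠ 0) :
    l m = d := by
  rw [coeff_cpt] at h
  by_contra h2
  simp [h2] at h

lemma cpt_bdd (l : (I → ℤ) →+ ℤ) (d : ℤ) (f : Lau I) : Bdd l d (cpt l d f) :=
  fun m hm => (cpt_homog l d f m hm).le

lemma cpt_cpt (l : (I → ℤ) →+ ℤ) (d : ℤ) (f : Lau I) : cpt l d (cpt l d f) = cpt l d f := by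
  ext m; simp only [coeff_cpt]; split_ifs <;> rfl

lemma cpt_mul_top {l : (I → ℤ) →+ ℤ} {a b : ℤ} {f g : Lau I} (hf : Bdd l a f) (hg : Bdd l b g) :
    cpt l (a + b) (f * g) = cpt l a f * cpt l b g := by
  have e : f * g = cpt l a f * cpt l b g + (cpt l a f * (g - cpt l b g) + (f - cpt l a f) * g) := by
    ring
  have h1 : cpt l (a + b) (cpt l a f * (g - cpt l b g)) = 0 :=
    cpt_eq_zero ((cpt_bdd l a f).mul (bdd_sub_cpt hg)) (by omega)
  have h2 : cpt l (a + b) ((f - cpt l a f) * g) = 0 :=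
    cpt_eq_zero ((bdd_sub_cpt hf).mul hg) (by omega)
  rw [e, cpt_add, cpt_add, h1, h2, cpt_mul_homog l _ a _ _ (cpt_homog l a f)]
  simp [cpt_cpt]

lemma exists_bdd (l : (I → ℤ) →+ ℤ) (f : Lau I) : ∃ c, Bdd l c f := by
  obtain ⟨c, hc⟩ := (f.coeff.support.image l).bddAbove
  refine ⟨c, fun m hm => hc ?_⟩
  simp only [Finset.coe_image]
  exact ⟨m, by simpa using hm, rfl⟩

/-- Cancelling a factor from a weight bound. -/
lemma bdd_of_mul {l : (I → ℤ) →+ ℤ} {a c : ℤ} {P g : Lau I} (hP : Bdd l a P)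
    (hP0 : cpt l a P ≠ 0) (h : Bdd l (a + c) (P * g)) : Bdd l c g := by
  obtain ⟨d, hd⟩ := exists_bdd l g
  have key : ∀ n : ℕ, Bdd l (c + n) g → Bdd l c g := by
    intro n
    induction n with
    | zero => intro h; simpa using h
    | succ n ih =>
      intro hb
      apply ih
      have h1 := cpt_mul_top hP hb
      rw [cpt_eq_zero h (by push_cast; omega)] at h1
      have h2 : cpt l (c + (n + 1 : ℕ)) g = 0 := by
        rcases mul_eq_zero.mp h1.symm with h3 | h3
        · exact absurd h3 hP0
        · exact h3
      have := bdd_sub_cpt hb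
      rw [h2, sub_zero] at this
      exact this.mono (by push_cast; omega)
  exact key (d - c).toNat (hd.mono (by omega))

/-- `W` is a nonzero divisor modulo `P`. -/
def Good (P W : Lau I) : Prop := W ≠ 0 ∧ ∀ g, P ∣ W * g → P ∣ g

lemma Good.mul {P V W : Lau I} (hV : Good P V) (hW : Good P W) : Good P (V * W) :=
  ⟨mul_ne_zero hV.1 hW.1, fun g hg => hW.2 g (hV.2 _ (by rwa [← mul_assoc]))⟩

lemma good_mon (P : Lau I) (m : I → ℤ) : Good P (mon m) := by
  refine ⟨by simp [mon], fun g hg => ?_⟩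
  have : g = mon (-m) * (mon m * g) := by rw [← mul_assoc, mon_neg_mul, one_mul]
  rw [this]
  exact hg.mul_left _

lemma good_of_top {l : (I → ℤ) →+ ℤ} {d0 : ℤ} {P W' : Lau I} {m0 : I → ℤ}
    (hP : ∀ m, P.coeff m ≠ 0 → l m = d0) (hW' : Bdd l (l m0 - 1) W') : Good P (mon m0 + W') := by
  classical
  have hWb : Bdd l (l m0) (mon m0 + W') := (Bdd.mon l m0).add (hW'.mono (by omega))
  have hWc : cpt l (l m0) (mon m0 + W') = mon m0 := by
    rw [cpt_add, cpt_eq_zero hW' (by omega), add_zero, mon, cpt_single, if_pos rfl]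
  refine ⟨?_, ?_⟩
  · intro h
    rw [h] at hWc
    have : (mon m0 : Lau I).coeff m0 = 0 := by rw [← hWc, coeff_cpt]; simp
    rw [coeff_mon_self] at this; omega
  have key : ∀ n : ℕ, ∀ lo : ℤ, ∀ g : Lau I, Bdd l (lo + n) g → (∀ m, g.coeff m ≠ 0 → lo < l m) →
      P ∣ (mon m0 + W') * g → P ∣ g := by
    intro n
    induction n with
    | zero =>
      intro lo g hb hlo _
      have : g = 0 := by
        ext m
        by_contra h
        have h1 := hb m h
        have h2 := hlo m h
        simp at h1
        omega
      rw [this]; exact dvd_zero _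
    | succ n ih =>
      intro lo g hb hlo hd
      obtain ⟨h, hh⟩ := hd
      set D : ℤ := lo + (n + 1 : ℕ) with hD
      have h1 : mon m0 * cpt l D g = P * cpt l (l m0 + D - d0) h := by
        rw [← cpt_mul_homog l _ d0 P h hP, ← hh, cpt_mul_top hWb hb, hWc]
      have h2 : P ∣ cpt l D g := (good_mon P m0).2 _ ⟨_, h1⟩
      have h3 : P ∣ g - cpt l D g := by
        apply ih lo
        · exact (bdd_sub_cpt hb).mono (by push_cast [hD]; omega)
        · intro m hm
          apply hlo
          intro h0
          apply hm
          rw [coeff_sub, Finsupp.sub_apply, coeff_cpt, h0]; simp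
        · rw [mul_sub]
          exact dvd_sub ⟨h, hh⟩ (h2.mul_left _)
      have := dvd_add h3 h2
      rwa [sub_add_cancel] at this
  intro g hg
  obtain ⟨d, hd⟩ := exists_bdd l g
  obtain ⟨d', hd'⟩ := exists_bdd (-l) g
  refine key (d + d' + 1).toNat (-d' - 1) g (hd.mono (by omega)) ?_ hg
  intro m hm
  have := hd' m hm
  simp at this
  omega

end alg
end CLI

namespace CLI
open AddMonoidAlgebra

set_option linter.unusedSectionVars false
set_option linter.unusedSimpArgs false
section charts
variable {I : Type} [Fintype I] [DecidableEq I] {K : Type} [Field K]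

/-- Positive part of an integer vector. -/
def pos (b : I → ℤ) : I → ℤ := fun i => max (b i) 0
/-- Negative part of an integer vector. -/
def neg (b : I → ℤ) : I → ℤ := fun i => max (-b i) 0
/-- Exchange polynomial. -/
noncomputable def P (b : I → ℤ) : Lau I := mon (pos b) + mon (neg b)
/-- Standard basis vector. -/
def ee (k : I) : I → ℤ := Pi.single k 1

lemma P_neg (b : I → ℤ) : P (-b) = P b := by
  have h1 : pos (-b) = neg b := rfl
  have h2 : neg (-b) = pos b := by ext i; simp [neg, pos]
  rw [P, P, h1, h2, add_comm]

lemma mon_ne_zero (φ : Lau I →+* K) (m : I → ℤ) : φ (mon m) ≠ 0 := by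
  intro h
  have := mon_neg_mul m
  apply_fun φ at this
  rw [map_mul, h, mul_zero, map_one] at this
  exact zero_ne_one this

lemma map_mon_neg (φ : Lau I →+* K) (m : I → ℤ) : φ (mon (-m)) = (φ (mon m))⁻¹ := by
  refine eq_inv_of_mul_eq_one_left ?_
  rw [← map_mul, mon_neg_mul, map_one]

lemma map_mon_zsmul (φ : Lau I →+* K) (n : ℤ) (m : I → ℤ) :
    φ (mon (n • m)) = (φ (mon m)) ^ n := by
  obtain ⟨k, rfl | rfl⟩ := n.eq_nat_or_neg
  · rw [natCast_zsmul, mon_nsmul, map_pow, zpow_natCast]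
  · rw [neg_smul, natCast_zsmul, map_mon_neg, mon_nsmul, map_pow, zpow_neg, zpow_natCast]

lemma map_mon_sum {J : Type*} (φ : Lau I →+* K) (s : Finset J) (f : J → I → ℤ) :
    φ (mon (∑ j ∈ s, f j)) = ∏ j ∈ s, φ (mon (f j)) := by
  classical
  induction s using Finset.induction_on with
  | empty => simp [mon_zero]
  | insert a s ha ih => rw [Finset.sum_insert ha, Finset.prod_insert ha, mon_add, map_mul, ih]

lemma eq_sum_ee (m : I → ℤ) : m = ∑ i, m i • ee i := by
  ext j
  simp [ee, Finset.sum_apply, Pi.single_apply]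

lemma map_mon (φ : Lau I →+* K) (m : I → ℤ) : φ (mon m) = ∏ i, φ (mon (ee i)) ^ m i := by
  conv_lhs => rw [eq_sum_ee m, map_mon_sum]
  simp only [map_mon_zsmul]

lemma single_eq_zsmul (m : I → ℤ) (c : ℤ) : (single m c : Lau I) = c • mon m := by
  simp [mon]

/-- Induction principle on Laurent polynomials. -/
lemma lau_induction {p : Lau I → Prop} (f : Lau I) (zero : p 0)
    (add : ∀ f g, p f → p g → p (f + g)) (hs : ∀ m c, p (single m c)) : p f := by
  induction f using AddMonoidAlgebra.induction_linear with
  | zero => exact zero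
  | add f g hf hg => exact add f g hf hg
  | single n b => exact hs n b

lemma chart_ext {φ ψ : Lau I →+* K} (h : ∀ i, φ (mon (ee i)) = ψ (mon (ee i))) : φ = ψ := by
  refine RingHom.ext fun f => ?_
  induction f using lau_induction with
  | zero => simp
  | add f g hf hg => rw [map_add, map_add, hf, hg]
  | hs m c => rw [single_eq_zsmul, map_zsmul, map_zsmul, map_mon, map_mon ψ]; simp [h]

lemma exists_chart (u : I → K) (hu : ∀ i, u i ≠ 0) :
    ∃ φ : Lau I →+* K, ∀ i, φ (mon (ee i)) = u i := by
  let f : Multiplicative (I → ℤ) →* K :=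
    { toFun := fun m => ∏ i, u i ^ (m.toAdd i)
      map_one' := by simp
      map_mul' := by
        intro a b
        rw [← Finset.prod_mul_distrib]
        refine Finset.prod_congr rfl fun i _ => ?_
        rw [toAdd_mul, Pi.add_apply, zpow_add₀ (hu i)] }
  refine ⟨liftNCRingHom (Int.castRingHom K) f (fun _ _ => Commute.all _ _), fun i => ?_⟩
  change liftNC _ _ _ = _
  rw [mon, liftNC_single]
  simp [f, ee, Pi.single_apply]

/-- Mutation of charts. -/
structure Mut (b : I → ℤ) (k : I) (φ φ' : Lau I →+* K) : Prop where
  same : ∀ m : I → ℤ, m k = 0 → φ' (mon m) = φ (mon m)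
  exch : φ (mon (ee k)) * φ' (mon (ee k)) = φ (P b)

lemma Mut.P_eq {b c : I → ℤ} {k : I} {φ φ' : Lau I →+* K} (h : Mut b k φ φ') (hc : c k = 0) :
    φ' (P c) = φ (P c) := by
  rw [P, map_add, map_add, h.same _ (by simp [pos, hc]), h.same _ (by simp [neg, hc])]

lemma Mut.symm {b : I → ℤ} {k : I} {φ φ' : Lau I →+* K} (h : Mut b k φ φ') (hb : b k = 0) :
    Mut b k φ' φ :=
  ⟨fun m hm => (h.same m hm).symm, by rw [h.P_eq hb, ← h.exch, mul_comm]⟩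

lemma Mut.P_ne {b : I → ℤ} {k : I} {φ φ' : Lau I →+* K} (h : Mut b k φ φ') : φ (P b) ≠ 0 := by
  rw [← h.exch]; exact mul_ne_zero (mon_ne_zero _ _) (mon_ne_zero _ _)

lemma ee_of_ne {i k : I} (h : i ≠ k) : ee i k = 0 := by simp [ee, Pi.single_apply, h.symm]

lemma ee_self (k : I) : ee k k = 1 := by simp [ee]

lemma Mut.unique {b : I → ℤ} {k : I} {φ φ' φ'' : Lau I →+* K} (h : Mut b k φ φ')
    (h2 : Mut b k φ φ'') : φ' = φ'' := by
  refine chart_ext fun i => ?_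
  by_cases hi : i = k
  · subst hi
    have := h.exch.trans h2.exch.symm
    exact mul_left_cancel₀ (mon_ne_zero _ _) this
  · rw [h.same _ (ee_of_ne hi), h2.same _ (ee_of_ne hi)]

lemma coeff_P_pos (b : I → ℤ) : 0 < (P b).coeff (pos b) := by
  classical
  rw [P, mon, mon, coeff_add, Finsupp.add_apply, csa, csa, if_pos rfl]
  split_ifs <;> norm_num

lemma P_ne_zero (b : I → ℤ) : P b ≠ 0 := by
  intro h
  have := coeff_P_pos b
  rw [h] at this
  simp at this

lemma Mut.exists (b : I → ℤ) (k : I) {φ : Lau I →+* K} (hφ : Function.Injective φ) :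
    ∃ φ', Mut b k φ φ' := by
  have hP : φ (P b) ≠ 0 := (map_ne_zero_iff φ hφ).mpr (P_ne_zero b)
  obtain ⟨φ', h⟩ := exists_chart
    (fun i => if i = k then φ (P b) / φ (mon (ee k)) else φ (mon (ee i))) (by
      intro i
      split_ifs
      · exact div_ne_zero hP (mon_ne_zero _ _)
      · exact mon_ne_zero _ _)
  refine ⟨φ', fun m hm => ?_, ?_⟩
  · rw [map_mon φ', map_mon φ]
    refine Finset.prod_congr rfl fun i _ => ?_
    rw [h]
    by_cases hi : i = k
    · subst hi; rw [hm]; simp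
    · rw [if_neg hi]
  · rw [h, if_pos rfl, mul_div_cancel₀]
    exact mon_ne_zero _ _

/-- Negate the `k`th coordinate. -/
def refl (k : I) (m : I → ℤ) : I → ℤ := Function.update m k (-m k)

lemma refl_eq (k : I) (m : I → ℤ) : refl k m = m - (2 * m k) • ee k := by
  ext i
  by_cases h : i = k
  · subst h; simp [refl, ee]; ring
  · simp [refl, ee, h]

lemma refl_refl (k : I) (m : I → ℤ) : refl k (refl k m) = m := by
  simp [refl]

lemma Mut.mon {b : I → ℤ} {k : I} {φ φ' : Lau I →+* K} (h : Mut b k φ φ') (m : I → ℤ) (s : ℕ)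
    (hs : 0 ≤ s + m k) :
    φ' (mon m) * φ (P b) ^ s = φ (CLI.mon (refl k m) * P b ^ (s + m k).toNat) := by
  have e1 : m = (m - m k • ee k) + m k • ee k := by abel
  have e2 : refl k m = (m - m k • ee k) + (-m k) • ee k := by
    rw [refl_eq, two_mul, add_smul, neg_smul]; abel
  have hP := h.P_ne
  have hk := mon_ne_zero φ (ee k)
  have h3 : φ' (CLI.mon (ee k)) = φ (P b) * (φ (CLI.mon (ee k)))⁻¹ := by
    rw [← h.exch]; field_simp
  have h4 : (φ (P b)) ^ (s + m k).toNat = φ (P b) ^ (s : ℤ) * φ (P b) ^ (m k) := by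
    rw [← zpow_natCast, Int.toNat_of_nonneg hs, zpow_add₀ hP]
  rw [map_mul, map_pow, h4]
  conv_lhs => rw [e1, mon_add, map_mul, map_mon_zsmul, h.same _ (by simp [ee_self])]
  rw [e2, mon_add, map_mul, map_mon_zsmul, h3, mul_zpow, inv_zpow, zpow_neg, zpow_natCast]
  ring

/-- Clearing denominators after substitution. -/
noncomputable def TT (b : I → ℤ) (k : I) (s : ℕ) (g : Lau I) : Lau I :=
  g.coeff.sum fun m c => single (refl k m) c * P b ^ (s + m k).toNat

lemma TT_add (b : I → ℤ) (k : I) (s : ℕ) (f g : Lau I) : TT b k s (f + g) = TT b k s f + TT b k s g := by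
  rw [TT, coeff_add, Finsupp.sum_add_index']
  · rfl
  · intro m; simp
  · intro m c d; rw [single_add, add_mul]

lemma TT_single (b : I → ℤ) (k : I) (s : ℕ) (m : I → ℤ) (c : ℤ) :
    TT b k s (single m c) = single (refl k m) c * P b ^ (s + m k).toNat := by
  rw [TT, coeff_single, Finsupp.sum_single_index (by simp)]

lemma TT_zero (b : I → ℤ) (k : I) (s : ℕ) : TT b k s 0 = 0 := by
  simp [TT]

lemma Mut.TT {b : I → ℤ} {k : I} {φ φ' : Lau I →+* K} (h : Mut b k φ φ') (g : Lau I) (s : ℕ)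
    (hs : ∀ m, g.coeff m ≠ 0 → 0 ≤ s + m k) :
    φ' g * φ (P b) ^ s = φ (CLI.TT b k s g) := by
  have e : φ' g = ∑ m ∈ g.coeff.support, φ' (single m (g.coeff m)) := by
    conv_lhs => rw [← sum_coeff_single g]
    rw [Finsupp.sum, map_sum]
  rw [e, CLI.TT, Finsupp.sum, map_sum, Finset.sum_mul]
  refine Finset.sum_congr rfl fun m hm => ?_
  rw [single_eq_zsmul, single_eq_zsmul, map_zsmul, smul_mul_assoc, smul_mul_assoc, map_zsmul,
    h.mon m s (hs m (Finsupp.mem_support_iff.mp hm))]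

lemma exists_s (k : I) (g : Lau I) : ∃ s0 : ℕ, ∀ s : ℕ, s0 ≤ s → ∀ m, g.coeff m ≠ 0 → 0 ≤ s + m k := by
  obtain ⟨c, hc⟩ := exists_bdd (-(Pi.evalAddMonoidHom (fun _ : I => ℤ) k)) g
  refine ⟨c.toNat, fun s hs m hm => ?_⟩
  have := hc m hm
  simp at this
  omega

lemma P_homog {l : (I → ℤ) →+ ℤ} {d : ℤ} {b : I → ℤ} (h1 : l (pos b) = d) (h2 : l (neg b) = d) :
    ∀ m, (P b).coeff m ≠ 0 → l m = d := by
  classical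
  intro m hm
  rw [P, mon, mon, coeff_add, Finsupp.add_apply, csa, csa] at hm
  split_ifs at hm with h3 h4 h4
  · rw [← h3, h1]
  · rw [← h3, h1]
  · rw [← h4, h2]
  · simp at hm

lemma pow_homog {l : (I → ℤ) →+ ℤ} {Q : Lau I} (h : ∀ m, Q.coeff m ≠ 0 → l m = 0) (n : ℕ) :
    ∀ m, (Q ^ n).coeff m ≠ 0 → l m = 0 := by
  have h1 : Bdd l 0 Q := fun m hm => (h m hm).le
  have h2 : Bdd (-l) 0 Q := fun m hm => by simp [h m hm]
  intro m hm
  have h3 := h1.pow n m hm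
  have h4 := h2.pow n m hm
  simp at h3 h4
  omega

lemma cpt_TT (b : I → ℤ) (k : I) (hb : b k = 0) (s : ℕ) (d : ℤ) (g : Lau I) :
    cpt (Pi.evalAddMonoidHom (fun _ : I => ℤ) k) (-d) (TT b k s g) =
      mapDomain (refl k) (cpt (Pi.evalAddMonoidHom (fun _ : I => ℤ) k) d g) * P b ^ (s + d).toNat := by
  induction g using lau_induction with
  | zero => simp [TT_zero, cpt_zero]
  | add f g hf hg => rw [TT_add, cpt_add, hf, hg, cpt_add, mapDomain_add, add_mul]
  | hs m c =>
    rw [TT_single, mul_comm, cpt_mul_homog _ _ 0, cpt_single, cpt_single]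
    · simp only [Pi.evalAddMonoidHom_apply, refl, Function.update_self, sub_zero, neg_inj]
      split_ifs with h
      · rw [mapDomain_single, h, mul_comm]; simp [refl, h]
      · simp
    · exact pow_homog (P_homog (by simp [pos, hb]) (by simp [neg, hb])) _

lemma Mut.inj {b : I → ℤ} {k : I} {φ φ' : Lau I →+* K} (h : Mut b k φ φ') (hb : b k = 0)
    (hφ : Function.Injective φ) : Function.Injective φ' := by
  rw [injective_iff_map_eq_zero]
  intro g hg
  obtain ⟨s, hs⟩ := exists_s k g
  have h1 := h.TT g s (hs s le_rfl)
  rw [hg, zero_mul] at h1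
  have h2 := (injective_iff_map_eq_zero φ).mp hφ _ h1.symm
  ext m
  have h3 := cpt_TT b k hb s (m k) g
  rw [h2, cpt_zero] at h3
  have h4 := (mul_eq_zero.mp h3.symm).resolve_right (pow_ne_zero _ (P_ne_zero b))
  have h5 : cpt (Pi.evalAddMonoidHom (fun _ : I => ℤ) k) (m k) g = 0 := by
    have hi : Function.Injective (refl k : (I → ℤ) → _) := (Function.LeftInverse.injective (refl_refl k))
    apply mapDomain_injective hi
    rw [h4]; simp
  have h6 := coeff_cpt (Pi.evalAddMonoidHom (fun _ : I => ℤ) k) (m k) g m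
  rw [h5] at h6
  simpa using h6.symm

/-- Weight functional. -/
def wt (p : I → ℤ) : (I → ℤ) →+ ℤ where
  toFun m := ∑ i, p i * m i
  map_zero' := by simp
  map_add' := by intro a b; simp [mul_add, Finset.sum_add_distrib]

/-- Mutation of weights. -/
def mutW (b : I → ℤ) (k : I) (p : I → ℤ) : I → ℤ :=
  Function.update p k (max (wt p (pos b)) (wt p (neg b)) - p k)

lemma wt_ee (p : I → ℤ) (k : I) : wt p (ee k) = p k := by
  simp [wt, ee, Pi.single_apply]

lemma wt_update (p : I → ℤ) (k : I) (x : ℤ) (m : I → ℤ) :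
    wt (Function.update p k x) m = wt p m + (x - p k) * m k := by
  simp only [wt, AddMonoidHom.coe_mk, ZeroHom.coe_mk]
  rw [← Finset.add_sum_erase _ _ (Finset.mem_univ k), ← Finset.add_sum_erase _ (fun i => p i * m i) (Finset.mem_univ k)]
  rw [Finset.sum_congr rfl (g := fun i => p i * m i)]
  · simp; ring
  · intro i hi
    rw [Function.update_of_ne (Finset.ne_of_mem_erase hi)]

lemma mutW_mutW (b : I → ℤ) (k : I) (hb : b k = 0) (p : I → ℤ) : mutW b k (mutW b k p) = p := by
  have h1 : wt (mutW b k p) (pos b) = wt p (pos b) := by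
    rw [mutW, wt_update]; simp [pos, hb]
  have h2 : wt (mutW b k p) (neg b) = wt p (neg b) := by
    rw [mutW, wt_update]; simp [neg, hb]
  rw [mutW, h1, h2]
  ext i
  by_cases hi : i = k
  · subst hi; simp [mutW]
  · simp [mutW, hi]

lemma P_bdd (l : (I → ℤ) →+ ℤ) (b : I → ℤ) : Bdd l (max (l (pos b)) (l (neg b))) (P b) :=
  ((Bdd.mon l _).mono (le_max_left _ _)).add ((Bdd.mon l _).mono (le_max_right _ _))

lemma P_top (l : (I → ℤ) →+ ℤ) (b : I → ℤ) : cpt l (max (l (pos b)) (l (neg b))) (P b) ≠ 0 := by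
  classical
  intro h
  have h1 : ∀ m, (cpt l (max (l (pos b)) (l (neg b))) (P b)).coeff m = 0 := by rw [h]; simp
  rcases le_total (l (pos b)) (l (neg b)) with h2 | h2
  · have := h1 (neg b)
    rw [coeff_cpt, if_pos (by simp [h2]), P, mon, mon, coeff_add, Finsupp.add_apply, csa, csa, if_pos rfl] at this
    split_ifs at this <;> omega
  · have := h1 (pos b)
    rw [coeff_cpt, if_pos (by simp [h2])] at this
    have := coeff_P_pos b
    omega

lemma bdd_of_pow_mul {l : (I → ℤ) →+ ℤ} {a c : ℤ} {Q g : Lau I} (hP : Bdd l a Q)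
    (hP0 : cpt l a Q ≠ 0) (s : ℕ) (h : Bdd l (s * a + c) (Q ^ s * g)) : Bdd l c g := by
  induction s with
  | zero => simpa using h
  | succ s ih =>
    apply ih
    apply bdd_of_mul hP hP0
    convert h using 1
    · push_cast; ring
    · ring

/-- Weight bounds transport along mutation. -/
lemma Mut.bdd {b : I → ℤ} {k : I} {φ φ' : Lau I →+* K} (h : Mut b k φ φ')
    (hφ : Function.Injective φ) {p : I → ℤ} {c : ℤ} {g g' : Lau I} (hg : φ g = φ' g')
    (hc : Bdd (wt (mutW b k p)) c g') : Bdd (wt p) c g := by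
  obtain ⟨s, hs⟩ := exists_s k g'
  have hs := hs s le_rfl
  have h1 := h.TT g' s hs
  rw [← hg, ← map_pow, ← map_mul] at h1
  have h2 := hφ h1
  refine bdd_of_pow_mul (P_bdd (wt p) b) (P_top (wt p) b) s ?_
  rw [mul_comm (P b ^ s), h2, CLI.TT, Finsupp.sum]
  refine Bdd.sum _ fun m hm => ?_
  have hm := Finsupp.mem_support_iff.mp hm
  refine ((Bdd.single _ _ _).mul ((P_bdd (wt p) b).pow _)).mono ?_
  have h3 := hc m hm
  rw [mutW, wt_update] at h3
  have h4 := hs m hm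
  rw [Int.toNat_of_nonneg h4, refl_eq, map_sub, map_zsmul, wt_ee]
  simp only [smul_eq_mul]
  linarith

end charts
end CLI

namespace CLI
open AddMonoidAlgebra

set_option linter.unusedSectionVars false
set_option linter.unusedSimpArgs false
section ustep
variable {I : Type} [Fintype I] [DecidableEq I] {K : Type} [Field K]

/-- Elements that are fractions of elements coprime to `Q`. -/
def GG (φ : Lau I →+* K) (Q : Lau I) (x : K) : Prop :=
  ∃ W1 W2, Good Q W1 ∧ Good Q W2 ∧ x * φ W2 = φ W1

lemma good_one (Q : Lau I) : Good Q 1 := by rw [← mon_zero]; exact good_mon _ _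

lemma GG.of {φ : Lau I →+* K} {Q W : Lau I} (h : Good Q W) : GG φ Q (φ W) :=
  ⟨W, 1, h, good_one Q, by simp⟩

lemma GG.mul {φ : Lau I →+* K} {Q : Lau I} {x y : K} (hx : GG φ Q x) (hy : GG φ Q y) :
    GG φ Q (x * y) := by
  obtain ⟨a, b, ha, hb, h⟩ := hx
  obtain ⟨a', b', ha', hb', h'⟩ := hy
  refine ⟨a * a', b * b', ha.mul ha', hb.mul hb', ?_⟩
  rw [map_mul, map_mul, ← h, ← h']; ring

lemma GG.inv {φ : Lau I →+* K} (hφ : Function.Injective φ) {Q : Lau I} {x : K} (hx : GG φ Q x) :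
    GG φ Q x⁻¹ := by
  obtain ⟨a, b, ha, hb, h⟩ := hx
  refine ⟨b, a, hb, ha, ?_⟩
  have h1 : φ b ≠ 0 := (map_ne_zero_iff φ hφ).mpr hb.1
  have h2 : φ a ≠ 0 := (map_ne_zero_iff φ hφ).mpr ha.1
  have h3 : x ≠ 0 := by rintro rfl; rw [zero_mul] at h; exact h2 h.symm
  rw [← h]; field_simp

lemma GG.one (φ : Lau I →+* K) (Q : Lau I) : GG φ Q 1 := by
  have := GG.of (φ := φ) (good_one Q)
  rwa [map_one] at this

lemma GG.zpow {φ : Lau I →+* K} (hφ : Function.Injective φ) {Q : Lau I} {x : K} (hx : GG φ Q x)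
    (n : ℤ) : GG φ Q (x ^ n) := by
  have hn : ∀ n : ℕ, GG φ Q (x ^ n) := by
    intro n
    induction n with
    | zero => simpa using GG.one φ Q
    | succ n ih => rw [pow_succ]; exact ih.mul hx
  obtain ⟨k, rfl | rfl⟩ := n.eq_nat_or_neg
  · rw [zpow_natCast]; exact hn k
  · rw [zpow_neg, zpow_natCast]; exact (hn k).inv hφ

lemma GG.prod {φ : Lau I →+* K} {Q : Lau I} {J : Type*} (s : Finset J) (x : J → K)
    (h : ∀ j ∈ s, GG φ Q (x j)) : GG φ Q (∏ j ∈ s, x j) := by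
  classical
  induction s using Finset.induction_on with
  | empty => simpa using GG.one φ Q
  | insert a s ha ih =>
    rw [Finset.prod_insert ha]
    exact (h a (by simp)).mul (ih fun j hj => h j (by simp [hj]))

lemma descend {φ1 φ2 φs : Lau I →+* K} {c : I → ℤ} {j : I} (hc : c j = 0) (h2 : Mut c j φ1 φ2)
    (hφ : Function.Injective φ2) (hG : ∀ i, GG φ2 (P c) (φs (mon (ee i)))) {f : K}
    (hf1 : f ∈ φ1.range) (hfs : f ∈ φs.range) : f ∈ φ2.range := by
  obtain ⟨g1, rfl⟩ := hf1
  obtain ⟨h, hh⟩ := hfs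
  have hW : ∀ h : Lau I, ∃ W, Good (P c) W ∧ ∃ v, φs h * φ2 W = φ2 v := by
    intro h
    induction h using lau_induction with
    | zero => exact ⟨1, good_one _, 0, by simp⟩
    | add f g hf hg =>
      obtain ⟨W, hW, v, hv⟩ := hf
      obtain ⟨W', hW', v', hv'⟩ := hg
      refine ⟨W * W', hW.mul hW', v * W' + W * v', ?_⟩
      rw [map_add φ2, map_mul φ2, map_mul φ2, map_mul φ2, ← hv, ← hv', map_add]; ring
    | hs m a =>
      have : GG φ2 (P c) (φs (mon m)) := by
        rw [map_mon]
        exact GG.prod _ _ fun i _ => (hG i).zpow hφ _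
      obtain ⟨W1, W2, -, hW2, e⟩ := this
      refine ⟨W2, hW2, a • W1, ?_⟩
      rw [single_eq_zsmul, map_zsmul, map_zsmul, ← e, smul_mul_assoc]
  obtain ⟨W, hW, v, hv⟩ := hW h
  rw [hh] at hv
  obtain ⟨s, hs⟩ := exists_s j g1
  have h3 := (h2.symm hc).TT g1 s (hs s le_rfl)
  set u := TT c j s g1 with hu
  have h4 : W * u = v * P c ^ s := by
    apply hφ
    rw [map_mul, map_mul, ← h3, ← hv, map_pow]; ring
  have key : ∀ s : ℕ, ∀ u, P c ^ s ∣ W * u → P c ^ s ∣ u := by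
    intro s
    induction s with
    | zero => intro u _; simp
    | succ s ih =>
      intro u hd
      have : P c ∣ W * u := (dvd_pow_self _ (Nat.succ_ne_zero s)).trans hd
      obtain ⟨u', rfl⟩ := hW.2 u this
      rw [pow_succ'] at hd ⊢
      apply mul_dvd_mul_left
      apply ih
      rw [mul_left_comm] at hd
      exact (mul_dvd_mul_iff_left (P_ne_zero c)).mp hd
  obtain ⟨w, hw⟩ := key s u ⟨v, by rw [h4, mul_comm]⟩
  refine ⟨w, ?_⟩
  rw [hw, map_mul, map_pow, mul_comm] at h3
  exact (mul_left_cancel₀ (pow_ne_zero _ (h2.symm hc).P_ne) h3).symm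

lemma pos_sub_neg (b : I → ℤ) : pos b = b + neg b := by
  ext i; simp only [pos, neg, Pi.add_apply]; omega

lemma P_eq (b : I → ℤ) : P b = mon (neg b) * (1 + mon b) := by
  rw [P, pos_sub_neg, mon_add]; ring

/-- The main case of the upper bound step. -/
lemma ustep_pos {φ φ1 φ2 φs : Lau I →+* K} {β γ γ' : I → ℤ} {j k : I} {c : ℕ} (hjk : j ≠ k)
    (hc : 0 < c) (hβk : β k = 0) (hγj : γ j = 0) (hγk : γ k = c) (hβj : β j = -c)
    (hγ' : γ' = γ - (2 * c) • ee k + c • pos β)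
    (h1 : Mut β k φ φ1) (hs : Mut γ j φ φs) (h2 : Mut γ' j φ1 φ2) (hφ : Function.Injective φ2)
    {f : K} (hf1 : f ∈ φ1.range) (hfs : f ∈ φs.range) : f ∈ φ2.range := by
  have hpj : pos β j = 0 := by simp only [pos, hβj]; omega
  have hnj : neg β j = c := by simp only [neg, hβj]; omega
  have hγ'j : γ' j = 0 := by rw [hγ']; simp [hγj, hpj, ee_of_ne hjk.symm]
  set l : (I → ℤ) →+ ℤ := Pi.evalAddMonoidHom (fun _ : I => ℤ) j with hl
  have la : ∀ m, l m = m j := fun m => rfl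
  have hPh : ∀ m, (P γ').coeff m ≠ 0 → l m = 0 :=
    P_homog (by simp [la, pos, hγ'j]) (by simp [la, neg, hγ'j])
  have hPb : Bdd l 0 (P γ') := fun m hm => (hPh m hm).le
  set Z : Lau I := P γ' * mon (-ee j) with hZ
  have hZb : Bdd l (-1) Z := by
    have := hPb.mul (Bdd.mon l (-ee j))
    simpa [la, ee_self] using this
  have hZp : ∀ n : ℕ, Bdd l (-n) (Z ^ n) := fun n => by
    have := hZb.pow n
    simpa using this
  set Y : Lau I := mon (neg β - c • ee j) * Z ^ c with hY
  have hYb : Bdd l (-1) Y := by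
    have := (Bdd.mon l (neg β - c • ee j)).mul (hZp c)
    refine this.mono ?_
    simp [la, ee_self, hnj]; omega
  set Wk : Lau I := mon (pos β) + Y with hWk
  have hWkb : Bdd l 0 Wk := by
    refine Bdd.add ?_ (hYb.mono (by omega))
    have := Bdd.mon l (pos β)
    simpa [la, hpj] using this
  have hWkg : Good (P γ') Wk := good_of_top hPh (by simpa [la, hpj] using hYb)
  set Q : Lau I := ∑ i ∈ Finset.range c, Wk ^ i * mon (pos β) ^ (c - 1 - i) with hQ
  have hQb : Bdd l 0 Q := by
    refine Bdd.sum _ fun i _ => ?_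
    have h3 := (hWkb.pow i).mul ((Bdd.mon l (pos β)).pow (c - 1 - i))
    simpa [la, hpj] using h3
  have hQe : Wk ^ c = mon (pos β) ^ c + Y * Q := by
    have := Commute.mul_geom_sum₂ (Commute.all Wk (mon (pos β))) c
    have e : Wk - mon (pos β) = Y := by rw [hWk]; ring
    rw [e] at this
    rw [hQ, this]; ring
  set V : Lau I := mon (γ - (2 * c) • ee k) * mon (neg β - c • ee j) * Z ^ (c - 1) * Q with hV
  have hVb : Bdd l 0 V := by
    have := (((Bdd.mon l (γ - (2 * c) • ee k)).mul (Bdd.mon l (neg β - c • ee j))).mul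
      (hZp (c - 1))).mul hQb
    refine this.mono ?_
    simp [la, ee_self, hnj, hγj, ee_of_ne hjk.symm]
  set Wj : Lau I := mon (ee j - neg γ') + V with hWj
  have hWjg : Good (P γ') Wj := good_of_top hPh (hVb.mono (by simp [la, ee_self, neg, hγ'j]))
  -- images
  have ej : φ (mon (ee j)) = φ2 Z := by
    rw [← h1.same _ (ee_of_ne hjk), hZ, map_mul, map_mon_neg, h2.P_eq hγ'j, ← h2.exch]
    have := mon_ne_zero φ2 (ee j)
    field_simp
  have eP : φ (P β) = φ2 Wk := by
    have e1 : neg β = (neg β - c • ee j) + c • ee j := by abel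
    rw [P, map_add, hWk, map_add]
    congr 1
    · rw [h2.same _ hpj, h1.same _ (by simp [pos, hβk])]
    · rw [hY, map_mul, map_pow, ← ej, ← map_pow, ← mon_nsmul]
      rw [h2.same _ (by simp [hnj, ee_self]), h1.same _ (by simp [neg, hβk, ee_of_ne hjk]),
        ← map_mul, ← mon_add, ← e1]
  have ek : φ (mon (ee k)) = φ2 Wk * φ2 (mon (-ee k)) := by
    rw [map_mon_neg, ← eP, ← h1.exch, h2.same _ (ee_of_ne hjk.symm)]
    have := mon_ne_zero φ1 (ee k)
    field_simp
  have eγ : φ (mon γ) = φ2 (mon (γ - (2 * c) • ee k) * Wk ^ c) := by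
    have e1 : γ = (γ - c • ee k) + c • ee k := by abel
    have e2 : γ - (2 * c) • ee k = (γ - c • ee k) + c • (-ee k) := by
      rw [two_mul, add_smul, smul_neg]; abel
    conv_lhs => rw [e1, mon_add, map_mul, mon_nsmul, map_pow, ek]
    rw [e2, mon_add, mon_nsmul, map_mul, map_mul, map_pow, map_pow,
      h2.same (γ - c • ee k) (by simp [hγj, ee_of_ne hjk.symm]),
      h1.same (γ - c • ee k) (by simp [hγk, ee_self])]
    ring
  have eV : 1 + mon (γ - (2 * c) • ee k) * Wk ^ c = Z * Wj := by
    have e1 : mon γ' = mon (γ - (2 * c) • ee k) * mon (pos β) ^ c := by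
      rw [hγ', mon_add, mon_nsmul]
    have e2 : Z * mon (ee j - neg γ') = 1 + mon γ' := by
      rw [hZ, P_eq]
      have : (mon (neg γ') * mon (-ee j) * mon (ee j - neg γ') : Lau I) = 1 := by
        rw [← mon_add, ← mon_add, ← mon_zero]; congr 1; abel
      linear_combination (1 + mon γ') * this
    have e3 : Z ^ c = Z * Z ^ (c - 1) := by
      rw [← pow_succ']; congr 1; omega
    rw [hWj, mul_add, e2, hQe, mul_add, ← e1, hV, hY, e3]; ring
  have es : φs (mon (ee j)) = φ2 (mon (neg γ)) * φ2 Wj := by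
    have h3 := hs.exch
    rw [P_eq, map_mul φ, map_add φ, eγ, map_one, ← map_one φ2, ← map_add, eV, map_mul, ← ej] at h3
    have h4 : φ (mon (neg γ)) = φ2 (mon (neg γ)) := by
      rw [h2.same _ (by simp [neg, hγj]), h1.same _ (by simp [neg, hγk])]
    rw [h4] at h3
    have := mon_ne_zero φ (ee j)
    apply mul_left_cancel₀ this
    rw [h3]; ring
  refine descend hγ'j h2 hφ (fun i => ?_) hf1 hfs
  by_cases hij : i = j
  · subst hij; rw [es]; exact (GG.of (good_mon _ _)).mul (GG.of hWjg)
  rw [hs.same _ (ee_of_ne hij)]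
  by_cases hik : i = k
  · subst hik; rw [ek]; exact (GG.of hWkg).mul (GG.of (good_mon _ _))
  rw [← h1.same _ (ee_of_ne hik), ← h2.same _ (ee_of_ne hij)]
  exact GG.of (good_mon _ _)

lemma ustep_zero {φ φ1 φ2 φs : Lau I →+* K} {β γ : I → ℤ} {j k : I} (hjk : j ≠ k)
    (hγj : γ j = 0) (hγk : γ k = 0) (hβj : β j = 0)
    {l : (I → ℤ) →+ ℤ} (hl1 : l γ = 0) (hl2 : 0 < l β)
    (h1 : Mut β k φ φ1) (hs : Mut γ j φ φs) (h2 : Mut γ j φ1 φ2) (hφ : Function.Injective φ2)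
    {f : K} (hf1 : f ∈ φ1.range) (hfs : f ∈ φs.range) (hβk : β k = 0) : f ∈ φ2.range := by
  have hPh : ∀ m, (P γ).coeff m ≠ 0 → l m = l (neg γ) :=
    P_homog (by rw [pos_sub_neg, map_add, hl1, zero_add]) rfl
  have hg : Good (P γ) (P β) := by
    refine good_of_top hPh ((Bdd.mon l (neg β)).mono ?_)
    rw [pos_sub_neg, map_add]; omega
  refine descend hγj h2 hφ (fun i => ?_) hf1 hfs
  by_cases hij : i = j
  · subst hij
    have : φs (mon (ee i)) = φ2 (mon (ee i)) := by
      have e1 := h2.exch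
      rw [h1.P_eq hγk, ← hs.exch, h1.same _ (ee_of_ne hjk)] at e1
      exact (mul_left_cancel₀ (mon_ne_zero _ _) e1).symm
    rw [this]; exact GG.of (good_mon _ _)
  rw [hs.same _ (ee_of_ne hij)]
  by_cases hik : i = k
  · subst hik
    have : φ (mon (ee i)) = φ2 (P β) * φ2 (mon (-ee i)) := by
      rw [map_mon_neg, h2.P_eq hβj, h1.P_eq hβk, ← h1.exch, h2.same _ (ee_of_ne hij)]
      have := mon_ne_zero φ1 (ee i)
      field_simp
    rw [this]; exact (GG.of hg).mul (GG.of (good_mon _ _))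
  rw [← h1.same _ (ee_of_ne hik), ← h2.same _ (ee_of_ne hij)]
  exact GG.of (good_mon _ _)

/-- Matrix mutation. -/
def mutB (B : I → I → ℤ) (k : I) : I → I → ℤ := fun i j =>
  if i = k ∨ j = k then -B i j
  else B i j + (if B i k < 0 then -1 else 1) * max (B i k * B k j) 0

/-- A column of a matrix. -/
def col (B : I → I → ℤ) (k : I) : I → ℤ := fun i => B i k

/-- Skew-symmetry. -/
def Skew (B : I → I → ℤ) : Prop := ∀ i j, B i j = -B j i

lemma Skew.diag {B : I → I → ℤ} (h : Skew B) (i : I) : B i i = 0 := by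
  have := h i i; omega

lemma sgn_formula (a b : ℤ) : (if a < 0 then -1 else 1) * max (a * b) 0 =
    max a 0 * max b 0 - max (-a) 0 * max (-b) 0 := by
  rcases lt_or_ge a 0 with ha | ha
  · rw [if_pos ha, max_eq_right ha.le, max_eq_left (by omega : 0 ≤ -a)]
    rcases le_total b 0 with hb | hb
    · rw [max_eq_left (mul_nonneg_of_nonpos_of_nonpos ha.le hb), max_eq_left (by omega : 0 ≤ -b)]; ring
    · rw [max_eq_right (mul_nonpos_of_nonpos_of_nonneg ha.le hb), max_eq_right (by omega : -b ≤ 0)]; ring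
  · rw [if_neg (by omega), max_eq_left ha, max_eq_right (by omega : -a ≤ 0)]
    rcases le_total b 0 with hb | hb
    · rw [max_eq_right (mul_nonpos_of_nonneg_of_nonpos ha hb), max_eq_right hb]; ring
    · rw [max_eq_left (mul_nonneg ha hb), max_eq_left hb]; ring

lemma mutB_of_ne {B : I → I → ℤ} {i j k : I} (hi : i ≠ k) (hj : j ≠ k) :
    mutB B k i j = B i j + (max (B i k) 0 * max (B k j) 0 - max (-B i k) 0 * max (-B k j) 0) := by
  rw [mutB, if_neg (by tauto), sgn_formula]

lemma mutB_row (B : I → I → ℤ) (j k : I) : mutB B k k j = -B k j := by simp [mutB]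
lemma mutB_col (B : I → I → ℤ) (i k : I) : mutB B k i k = -B i k := by simp [mutB]

lemma Skew.mut {B : I → I → ℤ} (h : Skew B) (k : I) : Skew (mutB B k) := by
  intro i j
  by_cases hi : i = k
  · subst hi; rw [mutB_row, mutB_col, h]
  by_cases hj : j = k
  · subst hj; rw [mutB_row, mutB_col, h]
  rw [mutB_of_ne hi hj, mutB_of_ne hj hi, h i j, h j k, h i k, neg_neg, neg_neg]
  ring

lemma mutB_mutB (B : I → I → ℤ) (k : I) : mutB (mutB B k) k = B := by
  ext i j
  by_cases hi : i = k
  · subst hi; rw [mutB_row, mutB_row, neg_neg]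
  by_cases hj : j = k
  · subst hj; rw [mutB_col, mutB_col, neg_neg]
  rw [mutB_of_ne hi hj, mutB_of_ne hi hj, mutB_row, mutB_col]
  simp only [neg_neg]
  ring

lemma col_mutB_self (B : I → I → ℤ) (k : I) : col (mutB B k) k = -col B k := by
  ext i; simp [col, mutB_col]

lemma Mut.neg_iff {b : I → ℤ} {k : I} {φ φ' : Lau I →+* K} : Mut (-b) k φ φ' ↔ Mut b k φ φ' :=
  ⟨fun h => ⟨h.same, by rw [h.exch, P_neg]⟩, fun h => ⟨h.same, by rw [h.exch, P_neg]⟩⟩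

lemma ustep {B : I → I → ℤ} (hB : Skew B) {φ φ1 φ2 φs : Lau I →+* K} {j k : I} (hjk : j ≠ k)
    (hl : ∃ l : (I → ℤ) →+ ℤ, l (col B j) = 0 ∧ 0 < l (col B k))
    (h1 : Mut (col B k) k φ φ1) (hs : Mut (col B j) j φ φs) (h2 : Mut (col (mutB B k) j) j φ1 φ2)
    (hφ : Function.Injective φ) {f : K} (hf1 : f ∈ φ1.range) (hfs : f ∈ φs.range) :
    f ∈ φ2.range := by
  have hφ1 := h1.inj (hB.diag k) hφ
  have hφ2 := h2.inj ((hB.mut k).diag j) hφ1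
  rcases lt_trichotomy (B k j) 0 with hc | hc | hc
  · obtain ⟨c, hc'⟩ := Int.eq_ofNat_of_zero_le (show 0 ≤ -B k j by omega)
    refine ustep_pos (β := -col B k) (γ := -col B j) (γ' := -col (mutB B k) j) (c := c) hjk
      (by omega) (by simp [col, hB.diag]) (by simp [col, hB.diag]) (by simp [col, hc'])
      (by simp [col, hB j k, hc']) ?_ (Mut.neg_iff.mpr h1) (Mut.neg_iff.mpr hs)
      (Mut.neg_iff.mpr h2) hφ2 hf1 hfs
    ext i
    by_cases hi : i = k
    · subst hi
      simp [col, mutB_row, pos, hB.diag, ee_self]; omega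
    · simp [col, mutB_of_ne hi hjk, pos, ee_of_ne (Ne.symm hi), max_eq_right hc.le,
        max_eq_left (by omega : 0 ≤ -B k j), hc']
      ring
  · obtain ⟨l, hl1, hl2⟩ := hl
    have e : col (mutB B k) j = col B j := by
      ext i
      by_cases hi : i = k
      · subst hi; simp [col, mutB_row, hc]
      · simp [col, mutB_of_ne hi hjk, hc]
    rw [e] at h2
    exact ustep_zero (β := col B k) (γ := col B j) hjk (hB.diag j) hc (by simp [col, hB j k, hc]) hl1 hl2 h1 hs h2 hφ2 hf1 hfs
      (hB.diag k)
  · obtain ⟨c, hc'⟩ := Int.eq_ofNat_of_zero_le hc.le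
    refine ustep_pos (β := col B k) (γ := col B j) (γ' := col (mutB B k) j) (c := c) hjk
      (by omega) (by simp [col, hB.diag]) (by simp [col, hB.diag]) (by simp [col, hc'])
      (by simp [col, hB j k, hc']) ?_ h1 hs h2 hφ2 hf1 hfs
    ext i
    by_cases hi : i = k
    · subst hi
      simp [col, mutB_row, pos, hB.diag, ee_self]; omega
    · simp [col, mutB_of_ne hi hjk, pos, ee_of_ne (Ne.symm hi), max_eq_right (by omega : -B k j ≤ 0),
        max_eq_left hc.le, hc']
      ring

end ustep
end CLI

namespace CLI
open AddMonoidAlgebra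

set_option linter.unusedSectionVars false
set_option linter.unusedSimpArgs false
section laurent
variable {I : Type} [Fintype I] [DecidableEq I] {K : Type} [Field K]

/-- Existence of a dual family for the columns in `S`. -/
def Dual (S : Finset I) (B : I → I → ℤ) : Prop :=
  ∃ L : I → (I → ℤ) →+ ℤ, ∀ k ∈ S, ∀ j ∈ S, L k (col B j) = if k = j then 1 else 0

/-- The linear map realizing the change of columns under mutation. -/
def EE (b : I → ℤ) (k : I) : (I → ℤ) →+ (I → ℤ) where
  toFun m := m - (2 * m k) • ee k + m k • neg b
  map_zero' := by simp
  map_add' := by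
    intro x y
    ext i
    simp
    ring

lemma EE_apply (b : I → ℤ) (k : I) (m : I → ℤ) :
    EE b k m = m - (2 * m k) • ee k + m k • neg b := rfl

lemma EE_EE (b : I → ℤ) (k : I) (hb : b k = 0) (m : I → ℤ) : EE b k (EE b k m) = m := by
  have h : (EE b k m) k = - m k := by
    simp [EE_apply, ee_self, neg, hb]; ring
  rw [EE_apply b k (EE b k m), h, EE_apply]
  ext i
  simp
  ring

lemma col_mutB_ne {B : I → I → ℤ} (hB : Skew B) {j k : I} (hj : j ≠ k) :
    col (mutB B k) j = EE (col B k) k (col B j + max (B k j) 0 • col B k) := by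
  ext i
  have hk : (col B j + max (B k j) 0 • col B k) k = B k j := by
    simp [col, hB.diag]
  rw [EE_apply, hk]
  by_cases hi : i = k
  · subst hi
    simp [col, mutB_row, hB.diag, ee_self, neg]; ring
  · simp only [col, mutB_of_ne hi hj, ee_of_ne (Ne.symm hi), neg, Pi.add_apply, Pi.sub_apply,
      Pi.smul_apply, smul_eq_mul, mul_zero, sub_zero]
    have h1 : B i k = max (B i k) 0 - max (-B i k) 0 := by omega
    have h2 : B k j = max (B k j) 0 - max (-B k j) 0 := by omega
    linear_combination (-max (B k j) 0) * h1 - max (-B i k) 0 * h2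

lemma col_mutB_eq {B : I → I → ℤ} (hB : Skew B) (k : I) :
    col (mutB B k) k = EE (col B k) k (-col B k) := by
  rw [col_mutB_self, EE_apply]
  simp [col, hB.diag]

lemma Dual.mut {S : Finset I} {B : I → I → ℤ} (hB : Skew B) (h : Dual S B) {k : I} (hk : k ∈ S) :
    Dual S (mutB B k) := by
  obtain ⟨L, hL⟩ := h
  have hE := EE_EE (col B k) k (hB.diag k)
  refine ⟨fun i => if i = k then
      -((L k).comp (EE (col B k) k)) + ∑ j ∈ S.erase k, max (B k j) 0 • (L j).comp (EE (col B k) k)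
    else (L i).comp (EE (col B k) k), ?_⟩
  intro i hi j hj
  beta_reduce
  by_cases hik : i = k
  · subst hik
    rw [if_pos rfl]
    by_cases hji : j = i
    · subst hji
      rw [if_pos rfl, col_mutB_eq hB]
      simp only [AddMonoidHom.add_apply, AddMonoidHom.neg_apply, AddMonoidHom.comp_apply, hE,
        AddMonoidHom.finsetSum_apply, AddMonoidHom.smul_apply, map_neg, hL j hj j hj, if_true]
      rw [Finset.sum_eq_zero]
      · simp
      · intro x hx
        rw [hL x (Finset.mem_of_mem_erase hx) j hj, if_neg (Finset.ne_of_mem_erase hx)]; simp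
    · rw [if_neg (Ne.symm hji), col_mutB_ne hB hji]
      simp only [AddMonoidHom.add_apply, AddMonoidHom.neg_apply, AddMonoidHom.comp_apply, hE,
        AddMonoidHom.finsetSum_apply, AddMonoidHom.smul_apply, map_add, map_zsmul, hL i hi i hi,
        hL i hi j hj, if_neg (Ne.symm hji), if_true]
      have h0 : ∑ x ∈ S.erase i, max (B i x) 0 • (L x) (col B i) = 0 := by
        refine Finset.sum_eq_zero fun x hx => ?_
        rw [hL x (Finset.mem_of_mem_erase hx) i hi, if_neg (Finset.ne_of_mem_erase hx), smul_zero]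
      have h1 : ∑ x ∈ S.erase i, max (B i x) 0 • (L x) (col B j) = max (B i j) 0 := by
        rw [Finset.sum_eq_single_of_mem j (Finset.mem_erase.mpr ⟨hji, hj⟩)]
        · rw [hL j hj j hj, if_pos rfl]; simp
        · intro x hx hxj
          rw [hL x (Finset.mem_of_mem_erase hx) j hj, if_neg hxj, smul_zero]
      rw [h0, h1]
      simp
  · rw [if_neg hik]
    by_cases hjk : j = k
    · subst hjk
      rw [if_neg hik, col_mutB_eq hB, AddMonoidHom.comp_apply, hE, map_neg, hL i hi j hj,
        if_neg hik, neg_zero]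
    · rw [col_mutB_ne hB hjk, AddMonoidHom.comp_apply, hE, map_add, map_zsmul, hL i hi j hj,
        hL i hi k hk, if_neg hik, smul_zero, add_zero]

/-- A seed: exchange matrix and chart. -/
abbrev Sd (I K : Type) [Field K] : Type := (I → I → ℤ) × (Lau I →+* K)

/-- Adjacent seeds. -/
def Adj (S : Finset I) (s t : Sd I K) : Prop :=
  Skew s.1 ∧ ∃ k ∈ S, Mut (col s.1 k) k s.2 t.2 ∧ t.1 = mutB s.1 k

lemma Adj.symm {S : Finset I} {s t : Sd I K} (h : Adj S s t) : Adj S t s := by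
  obtain ⟨hB, k, hk, hm, e⟩ := h
  refine ⟨by rw [e]; exact hB.mut k, k, hk, ?_, by rw [e, mutB_mutB]⟩
  rw [e, col_mutB_self]
  exact Mut.neg_iff.mpr (hm.symm (hB.diag k))

/-- Mutation equivalence. -/
def Conn (S : Finset I) (s t : Sd I K) : Prop := Relation.ReflTransGen (Adj S) s t

lemma Conn.symm {S : Finset I} {s t : Sd I K} (h : Conn S s t) : Conn S t s := by
  unfold Conn at *
  induction h with
  | refl => exact Relation.ReflTransGen.refl
  | tail _ h ih => exact Relation.ReflTransGen.head h.symm ih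

lemma Conn.trans {S : Finset I} {s t u : Sd I K} (h : Conn S s t) (h' : Conn S t u) : Conn S s u :=
  Relation.ReflTransGen.trans h h'

lemma Adj.skew {S : Finset I} {s t : Sd I K} (h : Adj S s t) : Skew t.1 := h.symm.1

lemma Conn.skew {S : Finset I} {s t : Sd I K} (h : Conn S s t) (hs : Skew s.1) : Skew t.1 := by
  unfold Conn at *
  induction h with
  | refl => exact hs
  | tail _ h _ => exact h.skew

lemma Adj.inj {S : Finset I} {s t : Sd I K} (h : Adj S s t) (hs : Function.Injective s.2) :
    Function.Injective t.2 := by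
  obtain ⟨hB, k, hk, hm, e⟩ := h
  exact hm.inj (hB.diag k) hs

lemma Conn.inj {S : Finset I} {s t : Sd I K} (h : Conn S s t) (hs : Function.Injective s.2) :
    Function.Injective t.2 := by
  unfold Conn at *
  induction h with
  | refl => exact hs
  | tail _ h ih => exact h.inj ih

/-- Universal Laurentness near a seed. -/
def Univ (S : Finset I) (f : K) (s : Sd I K) : Prop :=
  f ∈ s.2.range ∧ ∀ k ∈ S, ∀ φ', Mut (col s.1 k) k s.2 φ' → f ∈ φ'.range

lemma univ_step {S : Finset I} {s t : Sd I K} (hD : Dual S s.1) (hi : Function.Injective s.2)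
    (h : Adj S s t) {f : K} (hf : Univ S f s) : Univ S f t := by
  obtain ⟨hB, k, hk, hm, e⟩ := h
  refine ⟨hf.2 k hk _ hm, fun j hj φ2 h2 => ?_⟩
  rw [e] at h2
  by_cases hjk : j = k
  · subst hjk
    rw [col_mutB_self] at h2
    have h3 := (hm.symm (hB.diag j)).unique (Mut.neg_iff.mp h2)
    rw [← h3]; exact hf.1
  · obtain ⟨φs, hs⟩ := Mut.exists (col s.1 j) j hi
    obtain ⟨L, hL⟩ := hD
    refine ustep hB hjk ⟨L k, ?_, ?_⟩ hm hs h2 hi (hf.2 k hk _ hm) (hf.2 j hj _ hs)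
    · rw [hL k hk j hj, if_neg (Ne.symm hjk)]
    · rw [hL k hk k hk, if_pos rfl]; norm_num

lemma univ_init (S : Finset I) {s : Sd I K} (hs : Skew s.1) (i : I) :
    Univ S (s.2 (mon (ee i))) s := by
  refine ⟨⟨_, rfl⟩, fun k _ φ' h => ?_⟩
  by_cases hik : i = k
  · subst hik
    refine ⟨P (col s.1 i) * mon (-ee i), ?_⟩
    rw [map_mul, map_mon_neg, h.P_eq (c := col s.1 i) (hs.diag i), ← h.exch]
    have := mon_ne_zero φ' (ee i)
    field_simp
  · exact ⟨_, h.same _ (ee_of_ne hik)⟩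

lemma laurent_aux {S : Finset I} {s t : Sd I K} (h : Conn S s t) (hD : Dual S s.1)
    (hi : Function.Injective s.2) {f : K} (hf : Univ S f s) :
    Univ S f t ∧ Dual S t.1 ∧ Function.Injective t.2 := by
  unfold Conn at h
  induction h with
  | refl => exact ⟨hf, hD, hi⟩
  | tail _ h ih =>
    refine ⟨univ_step ih.2.1 ih.2.2 h ih.1, ?_, h.inj ih.2.2⟩
    obtain ⟨hB, k, hk, hm, e⟩ := h
    rw [e]; exact ih.2.1.mut hB hk

lemma conn_dual {S : Finset I} {s t : Sd I K} (h : Conn S s t) (hD : Dual S s.1) :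
    Dual S t.1 := by
  unfold Conn at h
  induction h with
  | refl => exact hD
  | tail _ h ih =>
    obtain ⟨hB, k, hk, hm, e⟩ := h
    rw [e]; exact ih.mut hB hk

/-- Laurent phenomenon, full rank case. -/
lemma laurent_up {S : Finset I} {s t : Sd I K} (h : Conn S s t) (hs : Skew s.1) (hD : Dual S s.1)
    (hi : Function.Injective s.2) (i : I) : t.2 (mon (ee i)) ∈ s.2.range :=
  (laurent_aux h.symm (conn_dual h hD) (h.inj hi) (univ_init S (h.skew hs) i)).1.1

end laurent

section descent
variable {J : Type} [Fintype J] [DecidableEq J] {K : Type} [Field K]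

/-- Restriction of exponents. -/
def resA (J : Type) : (J ⊕ J → ℤ) →+ (J → ℤ) where
  toFun m := fun i => m (Sum.inl i)
  map_zero' := rfl
  map_add' := fun _ _ => rfl

/-- Setting the frozen variables to one. -/
noncomputable def pr (J : Type) : Lau (J ⊕ J) →+* Lau J := mapDomainRingHom ℤ (resA J)

lemma pr_mon (m : J ⊕ J → ℤ) : pr J (mon m) = mon (fun i => m (Sum.inl i)) := by
  rw [pr, mon, mapDomainRingHom_apply, mapDomain_single]; rfl

lemma pr_P (b : J ⊕ J → ℤ) : pr J (P b) = P (fun i => b (Sum.inl i)) := by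
  rw [P, map_add, pr_mon, pr_mon]; rfl

/-- Extended exchange matrix. -/
def ext (B : J → J → ℤ) : J ⊕ J → J ⊕ J → ℤ
  | Sum.inl i, Sum.inl j => B i j
  | Sum.inl i, Sum.inr j => if i = j then -1 else 0
  | Sum.inr i, Sum.inl j => if i = j then 1 else 0
  | Sum.inr _, Sum.inr _ => 0

lemma ext_skew {B : J → J → ℤ} (h : Skew B) : Skew (ext B) := by
  rintro (i | i) (j | j)
  · exact h i j
  · simp only [ext, eq_comm]; split_ifs <;> simp
  · simp only [ext, eq_comm]; split_ifs <;> simp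
  · simp [ext]

/-- The mutable indices. -/
def SS (J : Type) [Fintype J] : Finset (J ⊕ J) := Finset.univ.map Function.Embedding.inl

lemma ext_dual (B : J → J → ℤ) : Dual (SS J) (ext B) := by
  refine ⟨fun a => Sum.elim (fun k => Pi.evalAddMonoidHom (fun _ : J ⊕ J => ℤ) (Sum.inr k))
    (fun _ => 0) a, ?_⟩
  intro k hk j hj
  simp only [SS, Finset.mem_map, Finset.mem_univ, true_and, Function.Embedding.inl_apply] at hk hj
  obtain ⟨k, rfl⟩ := hk
  obtain ⟨j, rfl⟩ := hj
  simp [col, ext]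

/-- Comparison of two ring maps to a field via a common upstairs object. -/
lemma rel_mon {I' : Type} [Fintype I'] [DecidableEq I'] {K' : Type} [Field K']
    {ψ0 ψ : Lau I' →+* K'} {φ0 φ : Lau I' →+* K}
    (h : ∀ a, ∃ g, ψ (mon (ee a)) = ψ0 g ∧ φ0 g = φ (mon (ee a))) (m : I' → ℤ) (hm : ∀ a, 0 ≤ m a) :
    ∃ g, ψ (mon m) = ψ0 g ∧ φ0 g = φ (mon m) := by
  choose g hg using h
  refine ⟨∏ a, g a ^ (m a).toNat, ?_, ?_⟩
  · rw [map_mon, map_prod]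
    refine Finset.prod_congr rfl fun a _ => ?_
    rw [map_pow, ← (hg a).1, ← zpow_natCast, Int.toNat_of_nonneg (hm a)]
  · rw [map_mon φ, map_prod]
    refine Finset.prod_congr rfl fun a _ => ?_
    rw [map_pow, (hg a).2, ← zpow_natCast, Int.toNat_of_nonneg (hm a)]

lemma descent {s t : Sd J K} (h : Conn Finset.univ s t) (hs : Skew s.1)
    {K' : Type} [Field K'] (ψ0 : Lau (J ⊕ J) →+* K') (hψ : Function.Injective ψ0) :
    ∃ t' : Sd (J ⊕ J) K', Conn (SS J) (ext s.1, ψ0) t' ∧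
      (∀ i j, t'.1 (Sum.inl i) (Sum.inl j) = t.1 i j) ∧
      ∀ a, ∃ g, t'.2 (mon (ee a)) = ψ0 g ∧ (s.2.comp (pr J)) g = (t.2.comp (pr J)) (mon (ee a)) := by
  unfold Conn at h
  induction h with
  | refl => exact ⟨_, Relation.ReflTransGen.refl, fun _ _ => rfl, fun a => ⟨_, rfl, rfl⟩⟩
  | @tail t u h1 h ih =>
    obtain ⟨t', hc, hB', hg⟩ := ih
    obtain ⟨hB, k, -, hm, e⟩ := h
    have hti : Function.Injective t'.2 := hc.inj hψ
    have hts : Skew t'.1 := hc.skew (ext_skew hs)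
    obtain ⟨ψ, hψm⟩ := Mut.exists (col t'.1 (Sum.inl k)) (Sum.inl k) hti
    have hA : Adj (SS J) t' (mutB t'.1 (Sum.inl k), ψ) :=
      ⟨hts, Sum.inl k, by simp [SS], hψm, rfl⟩
    have hc' : Conn (SS J) (ext s.1, ψ0) (mutB t'.1 (Sum.inl k), ψ) := Relation.ReflTransGen.tail hc hA
    refine ⟨_, hc', ?_, ?_⟩
    · intro i j
      simp only [e, mutB, hB', Sum.inl.injEq]
    · intro a
      by_cases ha : a = Sum.inl k
      · subst ha
        obtain ⟨g, hgg⟩ := laurent_up hc' (ext_skew hs) (ext_dual s.1) hψ (Sum.inl k)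
        refine ⟨g, hgg.symm, ?_⟩
        obtain ⟨g1, h1, h2⟩ := hg (Sum.inl k)
        obtain ⟨ga, h3, h4⟩ := rel_mon hg (pos (col t'.1 (Sum.inl k))) (fun a => le_max_right _ _)
        obtain ⟨gb, h5, h6⟩ := rel_mon hg (neg (col t'.1 (Sum.inl k))) (fun a => le_max_right _ _)
        have h7 : g1 * g = ga + gb := by
          apply hψ
          rw [map_mul, map_add, ← h1, ← h3, ← h5, hgg]
          have := hψm.exch
          rwa [P, map_add] at this
        have h8 := congrArg (s.2.comp (pr J)) h7
        rw [map_mul, map_add, h2, h4, h6, ← map_add] at h8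
        have h9 : (t.2.comp (pr J)) (mon (pos (col t'.1 (Sum.inl k))) + mon (neg (col t'.1 (Sum.inl k)))) =
            t.2 (P (col t.1 k)) := by
          change (t.2 (pr J (P _))) = _
          rw [pr_P]
          congr 2
          ext i
          exact hB' i k
        have e2 : (fun i => ee (Sum.inl k : J ⊕ J) (Sum.inl i)) = ee k := by
          ext i; simp [ee, Pi.single_apply]
        rw [h9, ← hm.exch] at h8
        simp only [RingHom.comp_apply, pr_mon, e2] at h8 ⊢
        exact mul_left_cancel₀ (mon_ne_zero _ _) h8
      · obtain ⟨g, h1, h2⟩ := hg a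
        refine ⟨g, ?_, ?_⟩
        · rw [← h1]; exact hψm.same _ (ee_of_ne ha)
        · rw [h2]
          simp only [RingHom.comp_apply, pr_mon]
          refine (hm.same _ ?_).symm
          exact ee_of_ne ha

/-- Laurent phenomenon, coefficient free. -/
lemma laurent {s t : Sd J K} (h : Conn Finset.univ s t) (hs : Skew s.1) (i : J) :
    t.2 (mon (ee i)) ∈ s.2.range := by
  obtain ⟨t', -, -, hg⟩ := descent h hs (algebraMap (Lau (J ⊕ J)) (FractionRing (Lau (J ⊕ J))))
    (IsFractionRing.injective _ _)
  obtain ⟨g, -, h2⟩ := hg (Sum.inl i)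
  refine ⟨pr J g, ?_⟩
  have e2 : (fun i' => ee (Sum.inl i : J ⊕ J) (Sum.inl i')) = ee i := by
    ext i; simp [ee, Pi.single_apply]
  simpa only [RingHom.comp_apply, pr_mon, e2] using h2

lemma laurent_mon {s t : Sd J K} (h : Conn Finset.univ s t) (hs : Skew s.1) (m : J → ℤ)
    (hm : ∀ i, 0 ≤ m i) : t.2 (mon m) ∈ s.2.range := by
  rw [map_mon]
  refine Subring.prod_mem _ fun i _ => ?_
  rw [← Int.toNat_of_nonneg (hm i), zpow_natCast]
  exact Subring.pow_mem _ (laurent h hs i) _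

end descent
end CLI

namespace CLI
open AddMonoidAlgebra

set_option linter.unusedSectionVars false
set_option linter.unusedSimpArgs false
section key
variable {I : Type} [Fintype I] [DecidableEq I] {K : Type} [Field K]

/-- Coefficient extraction as an additive map. -/
noncomputable def cf (e : I → ℤ) : Lau I →+ ℤ where
  toFun f := f.coeff e
  map_zero' := by simp
  map_add' := by intro f g; simp

/-- Transport of weights along a mutation path. -/
lemma transport {s t : Sd I K} (h : Conn Finset.univ s t) (hi : Function.Injective s.2)
    (p : I → ℤ) : ∃ q : I → ℤ, ∀ f : K, (∀ u, Conn Finset.univ s u → f ∈ u.2.range) →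
      ∀ c g h, s.2 g = f → t.2 h = f → (Bdd (wt q) c g ↔ Bdd (wt p) c h) := by
  unfold Conn at h
  induction h generalizing p with
  | refl =>
    refine ⟨p, fun f _ c g h hg hh => ?_⟩
    rw [hi (hg.trans hh.symm)]
  | @tail t u h1 h ih =>
    have hti : Function.Injective t.2 := Conn.inj h1 hi
    have hui : Function.Injective u.2 := h.inj hti
    obtain ⟨hB, k, -, hm, e⟩ := h
    obtain ⟨q, hq⟩ := ih (mutW (col t.1 k) k p)
    refine ⟨q, fun f hf c g h hg hh => ?_⟩
    obtain ⟨h', hh'⟩ := hf t h1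
    rw [hq f hf c g h' hg hh']
    constructor
    · intro hb
      exact (hm.symm (hB.diag k)).bdd hui (hh.trans hh'.symm) hb
    · intro hb
      refine hm.bdd hti (hh'.trans hh.symm) ?_
      rwa [mutW_mutW (col t.1 k) k (hB.diag k)]

lemma exists_theta (I : Type) [Fintype I] [DecidableEq I] :
    ∃ θ : Lau I →+* ℚ, ∀ m, θ (mon m) = 1 := by
  obtain ⟨θ, h⟩ := exists_chart (fun _ : I => (1 : ℚ)) (by simp)
  refine ⟨θ, fun m => ?_⟩
  rw [map_mon]; simp [h]

lemma pos_mon {φ0 φ : Lau I →+* K} {θ : Lau I →+* ℚ}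
    (h : ∀ a, ∃ g, φ (mon (ee a)) = φ0 g ∧ 0 < θ g) (m : I → ℤ) (hm : ∀ a, 0 ≤ m a) :
    ∃ g, φ (mon m) = φ0 g ∧ 0 < θ g := by
  choose g hg using h
  refine ⟨∏ a, g a ^ (m a).toNat, ?_, ?_⟩
  · rw [map_mon, map_prod]
    refine Finset.prod_congr rfl fun a _ => ?_
    rw [map_pow, ← (hg a).1, ← zpow_natCast, Int.toNat_of_nonneg (hm a)]
  · rw [map_prod]
    refine Finset.prod_pos fun a _ => ?_
    rw [map_pow]
    exact pow_pos (hg a).2 _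

lemma positivity {s t : Sd I K} (h : Conn Finset.univ s t) (hs : Skew s.1)
    (hi : Function.Injective s.2) {θ : Lau I →+* ℚ} (hθ : ∀ m, θ (mon m) = 1) :
    ∀ i, ∃ g, t.2 (mon (ee i)) = s.2 g ∧ 0 < θ g := by
  unfold Conn at h
  induction h with
  | refl => exact fun i => ⟨_, rfl, by rw [hθ]; norm_num⟩
  | @tail t u h1 h ih =>
    have hu : Conn Finset.univ s u := Relation.ReflTransGen.tail h1 h
    obtain ⟨hB, k, -, hm, e⟩ := h
    intro i
    by_cases hik : i = k
    · subst hik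
      obtain ⟨g, hg⟩ := laurent hu hs i
      refine ⟨g, hg.symm, ?_⟩
      obtain ⟨g1, h1, h2⟩ := ih i
      obtain ⟨ga, h3, h4⟩ := pos_mon ih (pos (col t.1 i)) (fun a => le_max_right _ _)
      obtain ⟨gb, h5, h6⟩ := pos_mon ih (neg (col t.1 i)) (fun a => le_max_right _ _)
      have h7 : g1 * g = ga + gb := by
        apply hi
        rw [map_mul, map_add, ← h1, ← h3, ← h5, hg]
        have := hm.exch
        rwa [P, map_add] at this
      have h8 := congrArg θ h7
      rw [map_mul, map_add] at h8
      have h9 : 0 < θ g1 * θ g := by rw [h8]; exact add_pos h4 h6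
      exact (pos_iff_pos_of_mul_pos h9).mp h2
    · obtain ⟨g, h1, h2⟩ := ih i
      exact ⟨g, by rw [← h1, hm.same _ (ee_of_ne hik)], h2⟩

/-- The key lemma: a cluster monomial containing another one in its expansion equals it. -/
lemma key_lemma {s t : Sd I K} (h : Conn Finset.univ s t) (hs : Skew s.1)
    (hi : Function.Injective s.2) {a e : I → ℤ} (ha : ∀ i, 0 ≤ a i) (he : ∀ i, 0 ≤ e i)
    {g : Lau I} (hg : t.2 (mon a) = s.2 g) (hge : g.coeff e ≠ 0) :
    t.2 (mon a) = s.2 (mon e) := by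
  have ht := h.skew hs
  have hti := h.inj hi
  obtain ⟨h', hh'⟩ := laurent_mon h.symm ht e he
  have hle : ∀ p : I → ℤ, ∀ m, h'.coeff m ≠ 0 → wt p m ≤ wt p a := by
    intro p
    obtain ⟨q, hq⟩ := transport h hi p
    have r1 : ∀ u, Conn Finset.univ s u → t.2 (mon a) ∈ u.2.range := fun u hu =>
      laurent_mon (hu.symm.trans h) (hu.skew hs) a ha
    have r2 : ∀ u, Conn Finset.univ s u → s.2 (mon e) ∈ u.2.range := fun u hu =>
      laurent_mon hu.symm (hu.skew hs) e he
    have b1 := (hq _ r1 (wt p a) g (mon a) hg.symm rfl).mpr (Bdd.mon _ _)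
    have b2 := b1 e hge
    exact (hq _ r2 (wt p a) (mon e) h' rfl hh').mp ((Bdd.mon _ _).mono b2)
  have hsupp : ∀ m, h'.coeff m ≠ 0 → m = a := by
    intro m hm
    ext i
    have h1 := hle (ee i) m hm
    have h2 := hle (-ee i) m hm
    have w : ∀ m : I → ℤ, wt (ee i) m = m i := fun m => by
      simp [wt, ee, Pi.single_apply]
    have w' : ∀ m : I → ℤ, wt (-ee i) m = -m i := fun m => by
      simp [wt, ee, Pi.single_apply]
    rw [w, w] at h1
    rw [w', w'] at h2
    omega
  have hh : h' = h'.coeff a • mon a := by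
    rw [← single_eq_zsmul]
    classical
    ext m
    rw [csa]
    split_ifs with h1
    · rw [h1]
    · by_contra h2; exact h1 (hsupp m h2).symm
  set c := h'.coeff a
  have h1 : mon e = c • g := by
    apply hi
    rw [← hh', hh, map_zsmul, map_zsmul, hg]
  have h2 : 1 = c * g.coeff e := by
    have := congrArg (cf e) h1
    rw [map_zsmul, smul_eq_mul] at this
    exact (coeff_mon_self e).symm.trans this
  obtain ⟨θ, hθ⟩ := exists_theta I
  obtain ⟨g', e1, e2⟩ := pos_mon (positivity h hs hi hθ) a ha
  have e3 : g' = g := hi (e1.symm.trans hg)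
  subst e3
  have h3 : (1 : ℚ) = c * θ g' := by
    have := congrArg θ h1
    rw [hθ, map_zsmul] at this
    simpa using this
  have hc : 0 < c := by
    by_contra hc
    have hc' : (c : ℚ) ≤ 0 := by exact_mod_cast not_lt.mp hc
    have := mul_nonpos_of_nonpos_of_nonneg hc' e2.le
    rw [← h3] at this
    norm_num at this
  have hc1 : c = 1 := by
    have hd : c ∣ 1 := ⟨_, h2⟩
    have := Int.le_of_dvd one_pos hd
    omega
  rw [hg, h1, hc1, one_smul]

/-- Abstract linear independence over the integers. -/
lemma indep_abstract {s0 : Sd I K} (hs : Skew s0.1) (hi : Function.Injective s0.2) (p : K → Prop)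
    (hp : ∀ x, p x → ∃ t, Conn Finset.univ s0 t ∧ ∃ a : I → ℤ, (∀ i, 0 ≤ a i) ∧ x = t.2 (mon a)) :
    LinearIndependent ℤ (fun v : {x : K // p x} => (v : K)) := by
  rw [linearIndependent_iff']
  intro S c hc v0 hv0
  obtain ⟨s, hcs, e, he, hv⟩ := hp v0.1 v0.2
  have hss := hcs.skew hs
  have hsi := hcs.inj hi
  have hG : ∀ v : {x : K // p x}, ∃ G, s.2 G = v.1 := by
    intro v
    obtain ⟨t, ht, a, ha, h⟩ := hp v.1 v.2
    rw [h]
    exact laurent_mon (hcs.symm.trans ht) hss a ha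
  choose G hG using hG
  have h1 : ∑ v ∈ S, c v • G v = 0 := by
    apply hsi
    rw [map_sum, map_zero, ← hc]
    refine Finset.sum_congr rfl fun v _ => ?_
    rw [map_zsmul, hG]
  have h2 : ∑ v ∈ S, c v * (G v).coeff e = 0 := by
    have := congrArg (cf e) h1
    rw [map_sum, map_zero] at this
    simp only [map_zsmul, smul_eq_mul] at this
    exact this
  rw [Finset.sum_eq_single_of_mem v0 hv0] at h2
  · have : G v0 = mon e := by apply hsi; rw [hG, hv]
    rw [this, coeff_mon_self, mul_one] at h2
    exact h2
  · intro v _ hne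
    by_contra h3
    apply hne
    have hge : (G v).coeff e ≠ 0 := right_ne_zero_of_mul h3
    obtain ⟨t, ht, a, ha, h⟩ := hp v.1 v.2
    apply Subtype.ext
    rw [h, hv]
    exact key_lemma (hcs.symm.trans ht) hss hsi ha he (by rw [hG, h]) hge

end key
end CLI

namespace CLI
open AddMonoidAlgebra
section final

lemma indep_rat {K J : Type} [Field K] [Module ℚ K] {v : J → K} (h : LinearIndependent ℤ v) :
    LinearIndependent ℚ v := by
  rwa [LinearIndependent.iff_fractionRing ℤ ℚ] at h

lemma xvar_ne (r : ℕ) (i : Fin r) : Xvar r i ≠ 0 := by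
  rw [Xvar, Ne, IsFractionRing.to_map_eq_zero_iff]
  exact MvPolynomial.X_ne_zero i

lemma chartX_nonneg {r : ℕ} {φ : Lau (Fin r) →+* F r} (h : ∀ i, φ (mon (ee i)) = Xvar r i)
    (m : Fin r → ℤ) (hm : ∀ i, 0 ≤ m i) :
    φ (mon m) = algebraMap (MvPolynomial (Fin r) ℚ) (F r)
      (MvPolynomial.monomial (Finsupp.equivFunOnFinite.symm fun i => (m i).toNat) 1) := by
  rw [map_mon, MvPolynomial.monomial_eq, map_one, one_mul,
    Finsupp.prod_fintype _ _ (by simp), map_prod]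
  refine Finset.prod_congr rfl fun i _ => ?_
  rw [h, map_pow, ← Xvar, Finsupp.equivFunOnFinite_symm_apply_apply, ← zpow_natCast,
    Int.toNat_of_nonneg (hm i)]

lemma chartX_inj {r : ℕ} {φ : Lau (Fin r) →+* F r} (h : ∀ i, φ (mon (ee i)) = Xvar r i) :
    Function.Injective φ := by
  classical
  rw [injective_iff_map_eq_zero]
  intro f hf
  choose s hs using fun k => exists_s k f
  let N : Fin r → ℤ := fun i => s i
  have hN : ∀ m, f.coeff m ≠ 0 → ∀ i, 0 ≤ (m + N) i := by
    intro m hm i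
    have := hs i (s i) le_rfl m hm
    simp only [Pi.add_apply, N]; omega
  let T : (Fin r → ℤ) → (Fin r →₀ ℕ) := fun m =>
    Finsupp.equivFunOnFinite.symm fun i => ((m + N) i).toNat
  let p : MvPolynomial (Fin r) ℚ :=
    ∑ m ∈ f.coeff.support, (f.coeff m) • MvPolynomial.monomial (T m) (1 : ℚ)
  have e : φ f * φ (mon N) = algebraMap (MvPolynomial (Fin r) ℚ) (F r) p := by
    conv_lhs => rw [← sum_coeff_single f]
    rw [Finsupp.sum, map_sum, Finset.sum_mul, map_sum]
    refine Finset.sum_congr rfl fun m hm => ?_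
    rw [single_eq_zsmul, map_zsmul, smul_mul_assoc, ← map_mul, ← mon_add, map_zsmul,
      chartX_nonneg h _ (hN m (Finsupp.mem_support_iff.mp hm))]
  rw [hf, zero_mul] at e
  have hp : p = 0 := (IsFractionRing.to_map_eq_zero_iff (K := F r)).mp e.symm
  ext m
  by_contra hm
  have hm' : f.coeff m ≠ 0 := hm
  have h1 := congrArg (MvPolynomial.coeff (T m)) hp
  simp only [p] at h1
  rw [MvPolynomial.coeff_sum, Finset.sum_eq_single_of_mem m (Finsupp.mem_support_iff.mpr hm')] at h1
  · rw [MvPolynomial.coeff_smul, MvPolynomial.coeff_monomial, if_pos rfl] at h1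
    simp at h1; exact hm' h1
  · intro m' hm1 hne
    have hT : T m' ≠ T m := by
      intro hT
      apply hne
      ext i
      have h2 := DFunLike.congr_fun hT i
      simp only [T, Finsupp.equivFunOnFinite_symm_apply_apply] at h2
      have h3 := hN m hm' i
      have h4 := hN m' (Finsupp.mem_support_iff.mp hm1) i
      simp only [Pi.add_apply] at h2 h3 h4
      omega
    rw [MvPolynomial.coeff_smul, MvPolynomial.coeff_monomial, if_neg hT, smul_zero]

lemma P_image {r : ℕ} {φ : Lau (Fin r) →+* F r} {u : Fin r → F r} (h : ∀ i, φ (mon (ee i)) = u i)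
    (B : Matrix (Fin r) (Fin r) ℤ) (k : Fin r) :
    φ (P (col B k)) = (∏ i ∈ Finset.univ.filter fun i => 0 < B i k, u i ^ (B i k).toNat) +
      ∏ i ∈ Finset.univ.filter fun i => B i k < 0, u i ^ (-B i k).toNat := by
  rw [P, map_add, map_mon, map_mon φ (neg _), Finset.prod_filter, Finset.prod_filter]
  congr 1
  · refine Finset.prod_congr rfl fun i _ => ?_
    rw [h]
    simp only [pos, col]
    split_ifs with h1
    · rw [max_eq_left h1.le, ← zpow_natCast, Int.toNat_of_nonneg h1.le]
    · rw [max_eq_right (by omega), zpow_zero]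
  · refine Finset.prod_congr rfl fun i _ => ?_
    rw [h]
    simp only [neg, col]
    split_ifs with h1
    · rw [max_eq_left (by omega), ← zpow_natCast, Int.toNat_of_nonneg (by omega)]
    · rw [max_eq_right (by omega), zpow_zero]

lemma seed_chart {r : ℕ} {B0 : Matrix (Fin r) (Fin r) ℤ} (hB0 : Skew B0)
    {φ0 : Lau (Fin r) →+* F r} (h0 : ∀ i, φ0 (mon (ee i)) = Xvar r i)
    {u : Fin r → F r} {B : Matrix (Fin r) (Fin r) ℤ} (h : IsSeed r B0 u B) :
    ∃ φ : Lau (Fin r) →+* F r, Conn Finset.univ ((B0, φ0) : Sd (Fin r) (F r)) (B, φ) ∧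
      ∀ i, φ (mon (ee i)) = u i := by
  induction h with
  | init => exact ⟨φ0, Relation.ReflTransGen.refl, h0⟩
  | @mutate u B k _ ih =>
    obtain ⟨φ, hc, hu⟩ := ih
    have hi : Function.Injective φ := hc.inj (chartX_inj h0)
    obtain ⟨φ', hm⟩ := Mut.exists (col B k) k hi
    refine ⟨φ', Relation.ReflTransGen.tail hc ⟨hc.skew hB0, k, Finset.mem_univ _, hm, rfl⟩, ?_⟩
    intro i
    by_cases hik : i = k
    · subst hik
      rw [mutateU, Function.update_self, mutateVar, ← P_image hu, ← hu i, ← hm.exch,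
        mul_div_cancel_left₀ _ (mon_ne_zero _ _)]
    · rw [mutateU, Function.update_of_ne hik, hm.same _ (ee_of_ne hik), hu]

end final
end CLI

/-- **Linear independence of cluster monomials.** Assume the
initial exchange matrix `B0` is skew-symmetric. Then the set of all cluster
monomials, viewed as elements of `F = ℚ(X_1, …, X_r)`, is linearly independent
over `ℚ`. -/
theorem cluster_monomials_linearIndependent (r : ℕ) (hr : 1 ≤ r)
    (B0 : Matrix (Fin r) (Fin r) ℤ) (hB0 : ∀ i j, B0 i j = -B0 j i) :
    LinearIndependent ℚ
      (fun v : {x : F r // IsClusterMonomial r B0 x} => (v : F r)) := by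
  obtain ⟨φ0, h0⟩ := CLI.exists_chart (Xvar r) (CLI.xvar_ne r)
  refine CLI.indep_rat ?_
  refine CLI.indep_abstract (s0 := (B0, φ0)) hB0 (CLI.chartX_inj h0) _ ?_
  rintro x ⟨u, B, hS, e, rfl⟩
  obtain ⟨φ, hc, hu⟩ := CLI.seed_chart hB0 h0 hS
  refine ⟨_, hc, fun i => (e i : ℤ), fun i => Int.natCast_nonneg _, ?_⟩
  rw [CLI.map_mon]
  refine Finset.prod_congr rfl fun i _ => ?_
  rw [hu, zpow_natCast]
end
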